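/- Final number of edges in the reverse H-free process for a family of forbidden graphs. Let H_1,...,H_r be 2-balanced graphs forming the family 𝓗, let H ∈ 𝓗 be a member with d_2(H) = min_{F∈𝓗} d_2(F), and let J ∈ 𝓗 have e_J = max_{F∈𝓗} e_F. There are constants a, A > 0 (depending only on 𝓗) such that the final number of edges M_n of the reverse 𝓗-free process on n vertices has expectation satisfying a·n^{2−1/d_2(H)} ≤ E M_n ≤ A·n^{2−1/d_2(H)}. Furthermore, for every c > 0 there exists n_0 = n_0(c,𝓗) such that for all n ≥ n_0, |M_n − E M_n| ≤ √(E M_n)·(log n)^{4e_J} holds with probability at least 1 − n^{−c}. -/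

import Mathlib

open scoped ENNReal

noncomputable def prOf {α : Type*} (μ : PMF α) (E : Set α) : ℝ≥0∞ :=
  ∑' x : E, μ x

/-- `d_2(H) = (e_H - 1)/(v_H - 2)`. -/
noncomputable def d2 {β : Type*} [Fintype β] (H : SimpleGraph β) : ℝ :=
  ((H.edgeSet.ncard : ℝ) - 1) / ((Fintype.card β : ℝ) - 2)

/-- `H` is 2-balanced: `e_H ≥ 2` and every proper subgraph `G ⊊ H` with at least 3
vertices satisfies `(e_G - 1)/(v_G - 2) ≤ d_2(H)`. -/
def TwoBalanced {β : Type*} [Fintype β] (H : SimpleGraph β) : Prop :=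
  2 ≤ H.edgeSet.ncard ∧
    ∀ G : H.Subgraph, G ≠ ⊤ → 3 ≤ G.verts.ncard →
      ((G.edgeSet.ncard : ℝ) - 1) / ((G.verts.ncard : ℝ) - 2) ≤ d2 H

/-- The edge set `E` contains a copy of `H` using the edge `e`. -/
def copyAt {β V : Type*} (H : SimpleGraph β) (E : Set (Sym2 V)) (e : Sym2 V) : Prop :=
  ∃ φ : β ↪ V, (∀ a b, H.Adj a b → s(φ a, φ b) ∈ E) ∧ ∃ a b, H.Adj a b ∧ e = s(φ a, φ b)

/-- The edges of `E` that are contained in a copy of `H` inside `E`. -/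
noncomputable def removable {β : Type*} {n : ℕ} (H : SimpleGraph β)
    (E : Finset (Sym2 (Fin n))) : Finset (Sym2 (Fin n)) :=
  @Finset.filter _ (fun e => copyAt H (↑E) e) (Classical.decPred _) E


/-- The edges of `E` that are contained in a copy of some member of the family
`(Hs i)_{i}` inside `E`. -/
noncomputable def removableFam {r : ℕ} {β : Fin r → Type*} {n : ℕ}
    (Hs : ∀ i, SimpleGraph (β i)) (E : Finset (Sym2 (Fin n))) : Finset (Sym2 (Fin n)) :=
  @Finset.filter _ (fun e => ∃ i, copyAt (Hs i) (↑E) e) (Classical.decPred _) E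

/-- `fuel` steps of the reverse `𝓗`-free process: as long as some edge lies in a copy of
a member of the family, a uniformly random such edge is removed. -/
noncomputable def reverseIterFam {r : ℕ} {β : Fin r → Type*} {n : ℕ}
    (Hs : ∀ i, SimpleGraph (β i)) :
    ℕ → Finset (Sym2 (Fin n)) → PMF (Finset (Sym2 (Fin n)))
  | 0, E => PMF.pure E
  | fuel + 1, E =>
    if h : (removableFam Hs E).Nonempty then
      (PMF.uniformOfFinset (removableFam Hs E) h).bind
        (fun e => reverseIterFam Hs fuel (E.erase e))
    else PMF.pure E

/-- All edges of the complete graph `K_n` on `Fin n`. -/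
def allEdges (n : ℕ) : Finset (Sym2 (Fin n)) :=
  Finset.univ.filter (fun e => ¬ e.IsDiag)

/-- The law of the final graph (edge set) of the reverse `𝓗`-free process on `n`
vertices; since each step removes one edge, `(allEdges n).card` steps always suffice. -/
noncomputable def reverseFinalFam {r : ℕ} {β : Fin r → Type*}
    (Hs : ∀ i, SimpleGraph (β i)) (n : ℕ) : PMF (Finset (Sym2 (Fin n))) :=
  reverseIterFam Hs ((allEdges n).card) (allEdges n)

/-- The expected number of edges of a random graph (edge set). -/
noncomputable def expEdges {n : ℕ} (q : PMF (Finset (Sym2 (Fin n)))) : ℝ :=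
  ∑' s, (q s).toReal * (s.card : ℝ)
section PEsec
variable {α : Type*} [DecidableEq α]

/-- Expectation of `f` over a uniformly random sequence of `k` distinct elements of `S`. -/
noncomputable def PE : ℕ → Finset α → (List α → ℝ) → ℝ
  | 0, _, f => f []
  | k+1, S, f => (∑ e ∈ S, PE k (S.erase e) (fun l => f (e :: l))) / (S.card : ℝ)

def Vld (k : ℕ) (S : Finset α) (l : List α) : Prop :=
  l.Nodup ∧ l.length = k ∧ ∀ x ∈ l, x ∈ S

lemma Vld.cons {k : ℕ} {S : Finset α} {l : List α} {e : α} (he : e ∈ S)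
    (h : Vld k (S.erase e) l) : Vld (k+1) S (e :: l) := by
  obtain ⟨h1, h2, h3⟩ := h
  refine ⟨List.nodup_cons.2 ⟨fun h => ?_, h1⟩, by simp [h2], ?_⟩
  · simpa using h3 e h
  · intro x hx
    rcases List.mem_cons.1 hx with rfl | hx
    · exact he
    · exact Finset.mem_of_mem_erase (h3 x hx)

lemma PE_mono : ∀ (k : ℕ) (S : Finset α) (f g : List α → ℝ),
    (∀ l, Vld k S l → f l ≤ g l) → PE k S f ≤ PE k S g
  | 0, S, f, g, h => h [] ⟨List.nodup_nil, rfl, by simp⟩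
  | k+1, S, f, g, h => by
    simp only [PE]
    refine div_le_div_of_nonneg_right (Finset.sum_le_sum fun e he => ?_) (by positivity)
    exact PE_mono k _ _ _ fun l hl => h _ (hl.cons he)

lemma PE_congr (k : ℕ) (S : Finset α) (f g : List α → ℝ)
    (h : ∀ l, Vld k S l → f l = g l) : PE k S f = PE k S g :=
  le_antisymm (PE_mono k S f g fun l hl => (h l hl).le)
    (PE_mono k S g f fun l hl => (h l hl).ge)

lemma PE_add : ∀ (k : ℕ) (S : Finset α) (f g : List α → ℝ),
    PE k S (fun l => f l + g l) = PE k S f + PE k S g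
  | 0, S, f, g => rfl
  | k+1, S, f, g => by
    simp only [PE]
    rw [← add_div, ← Finset.sum_add_distrib]
    congr 1
    exact Finset.sum_congr rfl fun e _ => PE_add k _ _ _

lemma PE_mul : ∀ (k : ℕ) (S : Finset α) (c : ℝ) (f : List α → ℝ),
    PE k S (fun l => c * f l) = c * PE k S f
  | 0, S, c, f => rfl
  | k+1, S, c, f => by
    simp only [PE]
    rw [← mul_div_assoc, Finset.mul_sum]
    congr 1
    exact Finset.sum_congr rfl fun e _ => PE_mul k _ _ _

lemma PE_zero (k : ℕ) (S : Finset α) : PE k S (fun _ => 0) = 0 := by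
  simpa using PE_mul k S 0 (fun _ => 0)

lemma PE_sub (k : ℕ) (S : Finset α) (f g : List α → ℝ) :
    PE k S (fun l => f l - g l) = PE k S f - PE k S g := by
  have := PE_add k S f (fun l => (-1) * g l)
  rw [PE_mul] at this
  simpa [sub_eq_add_neg] using this

lemma PE_sum {ι : Type*} (s : Finset ι) (k : ℕ) (S : Finset α) (f : ι → List α → ℝ) :
    PE k S (fun l => ∑ i ∈ s, f i l) = ∑ i ∈ s, PE k S (f i) := by
  classical
  induction s using Finset.induction_on with
  | empty => simpa using PE_zero k S
  | insert a s ha ih =>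
    simp only [Finset.sum_insert ha]
    rw [PE_add, ih]

lemma PE_const : ∀ (k : ℕ) (S : Finset α) (c : ℝ), k ≤ S.card → PE k S (fun _ => c) = c
  | 0, S, c, h => rfl
  | k+1, S, c, h => by
    simp only [PE]
    rw [Finset.sum_congr rfl (g := fun _ => c)]
    · have : (S.card : ℝ) ≠ 0 := by
        have : 0 < S.card := by omega
        positivity
      simp; field_simp
    · intro e he
      apply PE_const
      rw [Finset.card_erase_of_mem he]; omega

lemma PE_nonneg (k : ℕ) (S : Finset α) (f : List α → ℝ)
    (h : ∀ l, Vld k S l → 0 ≤ f l) : 0 ≤ PE k S f := by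
  rw [← PE_zero k S]; exact PE_mono _ _ _ _ h

lemma PE_tail : ∀ (k : ℕ) (S : Finset α) (f : List α → ℝ), k + 1 ≤ S.card →
    PE (k+1) S (fun l => f l.tail) = PE k S f
  | 0, S, f, h => by
    simp only [PE, List.tail_cons, Finset.sum_const, nsmul_eq_mul]
    have : (S.card : ℝ) ≠ 0 := by
      have : 0 < S.card := by omega
      positivity
    field_simp
  | k+1, S, f, h => by
    rw [PE]
    simp only [List.tail_cons]
    have h1 : ∀ e ∈ S, PE (k+1) (S.erase e) f =
        ∑ e' ∈ S, if e' ≠ e then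
          PE k ((S.erase e).erase e') (fun l => f (e' :: l)) / ((S.card : ℝ) - 1) else 0 := by
      intro e he
      rw [PE, ← Finset.sum_filter, Finset.card_erase_of_mem he, Finset.sum_div]
      rw [Nat.cast_sub (by omega)]
      have : S.filter (fun e' => e' ≠ e) = S.erase e := by
        ext x; simp [and_comm]
      rw [this]; simp
    rw [Finset.sum_congr rfl h1, Finset.sum_comm, PE]
    congr 1
    refine Finset.sum_congr rfl fun e' he' => ?_
    rw [← PE_tail k (S.erase e') (fun l => f (e' :: l))
      (by rw [Finset.card_erase_of_mem he']; omega), PE, ← Finset.sum_filter,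
      Finset.card_erase_of_mem he', Finset.sum_div]
    have : S.filter (fun e => e' ≠ e) = S.erase e' := by
      ext x; simp [and_comm, eq_comm]
    rw [this]
    refine Finset.sum_congr rfl fun e he => ?_
    rw [Nat.cast_sub (by omega), Finset.erase_right_comm]; simp

lemma PE_drop : ∀ (j k : ℕ) (S : Finset α) (f : List α → ℝ), k + j ≤ S.card →
    PE (k+j) S (fun l => f (l.drop j)) = PE k S f
  | 0, k, S, f, h => by simp
  | j+1, k, S, f, h => by
    rw [← PE_drop j k S f (by omega), ← PE_tail (k+j) S _ (by omega)]
    rw [← add_assoc]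
    congr 1
    funext l
    cases l <;> simp

lemma PE_swap (a b : α) : ∀ (k : ℕ) (S : Finset α) (f : List α → ℝ),
    PE k (S.image (Equiv.swap a b)) f = PE k S (fun l => f (l.map (Equiv.swap a b)))
  | 0, S, f => rfl
  | k+1, S, f => by
    rw [PE, PE, Finset.card_image_of_injective _ (Equiv.injective _),
      Finset.sum_image (fun _ _ _ _ h => (Equiv.injective _) h)]
    congr 1
    refine Finset.sum_congr rfl fun e he => ?_
    rw [← Finset.image_erase (Equiv.injective _), PE_swap a b k]
    rfl

lemma pow_add_ge (x y : ℝ) (hx : 0 ≤ x) (hy : 0 ≤ y) :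
    ∀ t : ℕ, x ^ (t+1) + (t+1 : ℝ) * x ^ t * y ≤ (x + y) ^ (t+1)
  | 0 => by simp
  | t+1 => by
    have := pow_add_ge x y hx hy t
    have h2 : (x ^ (t+1) + (t+1 : ℝ) * x ^ t * y) * (x + y) ≤ (x+y)^(t+1) * (x+y) :=
      mul_le_mul_of_nonneg_right this (by positivity)
    rw [← pow_succ] at h2
    refine le_trans ?_ h2
    have : 0 ≤ (t+1:ℝ) * x^t * y * y := by positivity
    push_cast
    ring_nf at this ⊢
    linarith

lemma PE_subset : ∀ (k : ℕ) (S T : Finset α), T ⊆ S → k ≤ S.card →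
    PE k S (fun l => if T ⊆ l.toFinset then (1:ℝ) else 0) ≤ ((k : ℝ) / S.card) ^ T.card
  | 0, S, T, hT, hk => by
    simp only [PE, List.toFinset_nil, Finset.subset_empty]
    split_ifs with h
    · simp [h]
    · positivity
  | k+1, S, T, hT, hk => by
    rcases Nat.eq_zero_or_pos T.card with h0 | h0
    · rw [Finset.card_eq_zero] at h0
      subst h0
      simp only [Finset.empty_subset, if_true, Finset.card_empty, pow_zero]
      rw [PE_const _ _ _ hk]
    obtain ⟨t, ht⟩ : ∃ t, T.card = t + 1 := ⟨T.card - 1, by omega⟩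
    obtain ⟨s, hs⟩ : ∃ s, S.card = s + 1 := ⟨S.card - 1, by omega⟩
    have hTS := Finset.card_le_card hT
    rw [PE, ht, hs]
    set x : ℝ := (k : ℝ) / s with hx
    have hx0 : 0 ≤ x := by positivity
    have hks : k ≤ s := by omega
    have hx1 : x ≤ 1 := div_le_one_of_le₀ (by exact_mod_cast hks) (by positivity)
    have hterm : ∀ e ∈ S, PE k (S.erase e)
        (fun l => if T ⊆ (e :: l).toFinset then (1:ℝ) else 0) ≤
        if e ∈ T then x ^ t else x ^ (t+1) := by
      intro e he
      have hc : (S.erase e).card = s := by rw [Finset.card_erase_of_mem he]; omega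
      have h1 := PE_subset k (S.erase e) (T.erase e) (Finset.erase_subset_erase e hT)
        (by omega)
      rw [hc] at h1
      simp only [List.toFinset_cons, Finset.subset_insert_iff]
      refine h1.trans (le_of_eq ?_)
      split_ifs with h
      · rw [Finset.card_erase_of_mem h, ht]; simp [hx]
      · rw [Finset.erase_eq_of_notMem h, ht]
    have hsum := Finset.sum_le_sum hterm
    rw [Finset.sum_ite, Finset.sum_const, Finset.sum_const, Finset.filter_mem_eq_inter,
      Finset.inter_eq_right.2 hT, Finset.filter_not, Finset.filter_mem_eq_inter,
      Finset.inter_eq_right.2 hT, Finset.card_sdiff_of_subset hT, ht, hs, nsmul_eq_mul,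
      nsmul_eq_mul, Nat.cast_sub (by omega)] at hsum
    have hs1 : (0:ℝ) < (s + 1 : ℕ) := by positivity
    rw [div_le_iff₀ hs1]
    refine hsum.trans ?_
    have hy : ((k+1 : ℕ) : ℝ) / ((s+1 : ℕ) : ℝ) = x + (1 - x) / ((s+1 : ℕ) : ℝ) := by
      rcases Nat.eq_zero_or_pos s with h | h
      · have : k = 0 := by omega
        subst h; subst this; simp [hx]
      · have : (s:ℝ) ≠ 0 := by positivity
        rw [hx]; push_cast; field_simp; ring
    rw [hy]
    have := pow_add_ge x ((1 - x) / ((s+1 : ℕ) : ℝ)) hx0 (by apply div_nonneg <;> linarith) t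
    refine le_trans (le_of_eq ?_) (mul_le_mul_of_nonneg_right this hs1.le)
    push_cast
    have : (s:ℝ) + 1 ≠ 0 := by positivity
    field_simp
    ring

lemma PE_dom (E0 : Finset α) : ∀ (k : ℕ) (S : Finset α) (F : Finset α → ℝ), S ⊆ E0 →
    k ≤ S.card → Antitone F → (∀ T, ∀ e ∈ E0, e ∉ S → F (insert e T) = F T) →
    PE k S (fun l => F l.toFinset) ≤
      (∑ ω : Fin k → E0, F (Finset.univ.image (fun i => (ω i : α)))) / (E0.card : ℝ) ^ k
  | 0, S, F, hS, hk, hF, hins => by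
    simp [PE]
  | k+1, S, F, hS, hk, hF, hins => by
    have hScard : (0:ℝ) < S.card := by
      have : 0 < S.card := by omega
      positivity
    have hEcard : (0:ℝ) < E0.card := by
      have := Finset.card_le_card hS
      have : 0 < E0.card := by omega
      positivity
    set Q : (Finset α → ℝ) → ℝ := fun F =>
      (∑ ω : Fin k → E0, F (Finset.univ.image (fun i => (ω i : α)))) / (E0.card : ℝ) ^ k
      with hQ
    have hrec : (∑ ω : Fin (k+1) → E0, F (Finset.univ.image (fun i => (ω i : α)))) /
        (E0.card : ℝ) ^ (k+1) = (∑ e ∈ E0, Q (fun T => F (insert e T))) / E0.card := by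
      rw [pow_succ, ← div_div]
      congr 1
      rw [hQ]
      simp only
      rw [← Finset.sum_div]
      congr 1
      rw [← (Fin.consEquiv (fun _ => E0)).sum_comp, Fintype.sum_prod_type,
        ← Finset.sum_coe_sort E0]
      refine Finset.sum_congr rfl fun e _ => Finset.sum_congr rfl fun ω _ => ?_
      congr 1
      ext x
      simp [Fin.exists_fin_succ, Fin.consEquiv, eq_comm]
    have hQmono : ∀ F G : Finset α → ℝ, (∀ T, F T ≤ G T) → Q F ≤ Q G := by
      intro F G h
      rw [hQ]
      exact div_le_div_of_nonneg_right (Finset.sum_le_sum fun _ _ => h _) (by positivity)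
    rw [hrec, PE]
    have h1 : ∀ e ∈ S, PE k (S.erase e) (fun l => F (e :: l).toFinset) ≤
        Q (fun T => F (insert e T)) := by
      intro e he
      have := PE_dom E0 k (S.erase e) (fun T => F (insert e T))
        ((Finset.erase_subset _ _).trans hS) (by rw [Finset.card_erase_of_mem he]; omega)
        (fun A B h => hF (Finset.insert_subset_insert e h))
        (by
          intro T e' he' hne
          by_cases h : e' = e
          · subst h; simp
          · change F (insert e (insert e' T)) = F (insert e T)
            rw [Finset.insert_comm]
            exact hins _ e' he' (fun h' => hne (Finset.mem_erase.2 ⟨h, h'⟩)))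
      simpa using this
    have h2 : (∑ e ∈ S, Q (fun T => F (insert e T))) ≤ S.card * Q F := by
      rw [← nsmul_eq_mul]
      exact Finset.sum_le_card_nsmul _ _ _ fun e _ => hQmono _ _ fun T =>
        hF (Finset.subset_insert e T)
    have h3 : ∑ e ∈ E0, Q (fun T => F (insert e T)) =
        ∑ e ∈ S, Q (fun T => F (insert e T)) + (E0.card - S.card) * Q F := by
      rw [← Finset.sum_sdiff hS, add_comm]
      congr 1
      rw [Finset.sum_congr rfl (g := fun _ => Q F)]
      · rw [Finset.sum_const, Finset.card_sdiff_of_subset hS, nsmul_eq_mul,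
          Nat.cast_sub (Finset.card_le_card hS)]
      · intro e he
        rw [Finset.mem_sdiff] at he
        have : (fun T => F (insert e T)) = F := funext fun T => hins T e he.1 he.2
        rw [this]
    refine (div_le_div_of_nonneg_right (Finset.sum_le_sum h1) hScard.le).trans ?_
    rw [h3, div_le_div_iff₀ hScard hEcard]
    have : (S.card:ℝ) ≤ E0.card := by exact_mod_cast Finset.card_le_card hS
    nlinarith

lemma exp_chord (s c x : ℝ) (hc : 0 < c) (hx : |x| ≤ c) :
    Real.exp (s * x) ≤ Real.cosh (s * c) + x / c * Real.sinh (s * c) := by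
  have hx' := abs_le.1 hx
  have hu : -1 ≤ x / c := by rw [le_div_iff₀ hc]; linarith
  have hv : x / c ≤ 1 := by rw [div_le_iff₀ hc]; linarith
  have hu' : 0 ≤ (1 + x / c) / 2 := by linarith
  have hv' : 0 ≤ (1 - x / c) / 2 := by linarith
  have h := convexOn_exp.2 (Set.mem_univ (s * c)) (Set.mem_univ (-(s * c))) hu' hv' (by ring)
  · simp only [smul_eq_mul] at h
    have e1 : (1 + x / c) / 2 * (s * c) + (1 - x / c) / 2 * (-(s * c)) = s * x := by
      field_simp; ring
    rw [e1] at h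
    refine h.trans (le_of_eq ?_)
    rw [Real.cosh_eq, Real.sinh_eq]; ring

lemma avg_mgf (S : Finset α) (hS : 0 < S.card) (c s : ℝ) (hc : 0 < c) (g : α → ℝ)
    (hg : ∀ a ∈ S, ∀ b ∈ S, |g a - g b| ≤ c) :
    (∑ a ∈ S, Real.exp (s * (g a - (∑ b ∈ S, g b) / S.card))) / S.card ≤
      Real.exp (s ^ 2 * c ^ 2 / 2) := by
  have hS' : (0:ℝ) < S.card := by positivity
  set μ := (∑ b ∈ S, g b) / (S.card : ℝ) with hμ
  have hμ' : ∑ b ∈ S, g b = S.card * μ := by rw [hμ]; field_simp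
  have hd : ∀ a ∈ S, |g a - μ| ≤ c := by
    intro a ha
    have : S.card * (g a - μ) = ∑ b ∈ S, (g a - g b) := by
      rw [Finset.sum_sub_distrib, hμ', Finset.sum_const, nsmul_eq_mul]; ring
    have h2 : |(S.card : ℝ) * (g a - μ)| ≤ S.card * c := by
      rw [this]
      refine (Finset.abs_sum_le_sum_abs _ _).trans ?_
      rw [← nsmul_eq_mul]
      exact Finset.sum_le_card_nsmul _ _ _ fun b hb => hg a ha b hb
    rw [abs_mul, abs_of_pos hS'] at h2
    exact le_of_mul_le_mul_left h2 hS'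
  rw [div_le_iff₀ hS']
  have h1 : ∑ a ∈ S, Real.exp (s * (g a - μ)) ≤
      ∑ a ∈ S, (Real.cosh (s * c) + (g a - μ) / c * Real.sinh (s * c)) :=
    Finset.sum_le_sum fun a ha => exp_chord s c _ hc (hd a ha)
  refine h1.trans ?_
  rw [Finset.sum_add_distrib, ← Finset.sum_mul, ← Finset.sum_div, Finset.sum_sub_distrib, hμ',
    Finset.sum_const, Finset.sum_const, nsmul_eq_mul, nsmul_eq_mul, sub_self]
  have := Real.cosh_le_exp_half_sq (s * c)
  rw [mul_pow] at this
  simp only [zero_div, zero_mul, add_zero]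
  nlinarith

lemma PE_mgf (c s : ℝ) (hc : 0 < c) : ∀ (k : ℕ) (S : Finset α) (f : List α → ℝ), k ≤ S.card →
    (∀ l, Vld k S l → ∀ a ∈ S, ∀ b ∈ S, |f (l.map (Equiv.swap a b)) - f l| ≤ c) →
    PE k S (fun l => Real.exp (s * (f l - PE k S f))) ≤ Real.exp (k * (s ^ 2 * c ^ 2 / 2))
  | 0, S, f, hk, hf => by simp [PE]
  | k+1, S, f, hk, hf => by
    set g : α → ℝ := fun a => PE k (S.erase a) (fun l => f (a :: l)) with hg
    have hμ : PE (k+1) S f = (∑ b ∈ S, g b) / S.card := rfl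
    have hcard : ∀ a ∈ S, k ≤ (S.erase a).card := by
      intro a ha; rw [Finset.card_erase_of_mem ha]; omega
    have hgd : ∀ a ∈ S, ∀ b ∈ S, |g a - g b| ≤ c := by
      intro a ha b hb
      have h1 : g b = PE k (S.erase a) (fun l => f ((a :: l).map (Equiv.swap a b))) := by
        have : S.erase b = (S.erase a).image (Equiv.swap a b) := by
          rw [Finset.image_erase (Equiv.injective _), Equiv.swap_apply_left]
          congr 1
          ext x
          simp only [Finset.mem_image]
          constructor
          · intro hx
            refine ⟨Equiv.swap a b x, ?_, by simp⟩
            rw [Equiv.swap_apply_def]; split_ifs <;> assumption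
          · rintro ⟨y, hy, rfl⟩
            rw [Equiv.swap_apply_def]; split_ifs <;> assumption
        simp only [hg]
        rw [this, PE_swap]
        simp
      have h2 : g a - g b = PE k (S.erase a)
          (fun l => f (a :: l) - f ((a :: l).map (Equiv.swap a b))) := by
        rw [PE_sub, ← h1]
      rw [h2, abs_le]
      have hb' : ∀ l, Vld k (S.erase a) l →
          |f (a :: l) - f ((a :: l).map (Equiv.swap a b))| ≤ c := by
        intro l hl
        rw [abs_sub_comm]
        exact hf _ (hl.cons ha) a ha b hb
      constructor
      · rw [← PE_const k (S.erase a) (-c) (hcard a ha)]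
        exact PE_mono _ _ _ _ fun l hl => (abs_le.1 (hb' l hl)).1
      · rw [← PE_const k (S.erase a) c (hcard a ha)]
        exact PE_mono _ _ _ _ fun l hl => (abs_le.1 (hb' l hl)).2
    rw [PE]
    have h1 : ∀ a ∈ S, PE k (S.erase a) (fun l => Real.exp (s * (f (a :: l) - PE (k+1) S f))) ≤
        Real.exp (s * (g a - (∑ b ∈ S, g b) / S.card)) * Real.exp (k * (s ^ 2 * c ^ 2 / 2)) := by
      intro a ha
      have hI := PE_mgf c s hc k (S.erase a) (fun l => f (a :: l)) (hcard a ha) (by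
        intro l hl x hx y hy
        have := hf _ (hl.cons ha) x (Finset.mem_of_mem_erase hx) y (Finset.mem_of_mem_erase hy)
        rw [List.map_cons, Equiv.swap_apply_of_ne_of_ne (Finset.ne_of_mem_erase hx).symm
          (Finset.ne_of_mem_erase hy).symm] at this
        exact this)
      rw [← hμ]
      refine le_trans (le_of_eq ?_) (mul_le_mul_of_nonneg_left hI (Real.exp_pos _).le)
      rw [← PE_mul]
      congr 1
      funext l
      rw [← Real.exp_add]
      congr 1
      simp only [hg]
      ring
    have hS : 0 < S.card := by omega
    refine (div_le_div_of_nonneg_right (Finset.sum_le_sum h1) (by positivity)).trans ?_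
    rw [← Finset.sum_mul, mul_div_right_comm]
    refine (mul_le_mul_of_nonneg_right (avg_mgf S hS c s hc g hgd) (Real.exp_pos _).le).trans ?_
    rw [← Real.exp_add]
    apply le_of_eq
    congr 1
    push_cast
    ring

/-- two-sided tail bound. -/
lemma PE_tail_bound (c t : ℝ) (hc : 0 < c) (ht : 0 ≤ t) (k : ℕ) (hk0 : 0 < k) (S : Finset α)
    (f : List α → ℝ) (hk : k ≤ S.card)
    (hf : ∀ l, Vld k S l → ∀ a ∈ S, ∀ b ∈ S, |f (l.map (Equiv.swap a b)) - f l| ≤ c) :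
    PE k S (fun l => if t < |f l - PE k S f| then 1 else 0) ≤
      2 * Real.exp (- (t ^ 2 / (2 * k * c ^ 2))) := by
  set μ := PE k S f with hμ
  set s := t / (k * c ^ 2) with hs
  have hkpos : (0:ℝ) < k := by positivity
  have hs0 : 0 ≤ s := by positivity
  have h1 := PE_mgf c s hc k S f hk hf
  have h2 := PE_mgf c (-s) hc k S f hk hf
  have hval : Real.exp (-(s*t)) * Real.exp (k * (s ^ 2 * c ^ 2 / 2)) =
      Real.exp (- (t ^ 2 / (2 * k * c ^ 2))) := by
    rw [← Real.exp_add]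
    congr 1
    rw [hs]; field_simp; ring
  have h3 : PE k S (fun l => if t < |f l - μ| then 1 else 0) ≤
      PE k S (fun l => Real.exp (-(s*t)) * Real.exp (s * (f l - μ)) +
        Real.exp (-(s*t)) * Real.exp (-s * (f l - μ))) := by
    refine PE_mono _ _ _ _ fun l _ => ?_
    split_ifs with h
    · rcases lt_abs.1 h with h | h
      · have : 1 ≤ Real.exp (-(s*t)) * Real.exp (s * (f l - μ)) := by
          rw [← Real.exp_add]
          apply Real.one_le_exp
          nlinarith
        have h' : 0 < Real.exp (-(s*t)) * Real.exp (-s * (f l - μ)) := by positivity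
        linarith
      · have : 1 ≤ Real.exp (-(s*t)) * Real.exp (-s * (f l - μ)) := by
          rw [← Real.exp_add]
          apply Real.one_le_exp
          nlinarith
        have h' : 0 < Real.exp (-(s*t)) * Real.exp (s * (f l - μ)) := by positivity
        linarith
    · positivity
  refine h3.trans ?_
  rw [PE_add, PE_mul, PE_mul]
  rw [neg_sq] at h2
  have e := (Real.exp_pos (-(s*t))).le
  have h4 := mul_le_mul_of_nonneg_left h1 e
  have h5 := mul_le_mul_of_nonneg_left h2 e
  rw [hval] at h4 h5
  linarith

end PEsec
section Proc
variable {r : ℕ} {β : Fin r → Type*} {n : ℕ}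

lemma copyAt_mono {γ V : Type*} {H : SimpleGraph γ} {E E' : Set (Sym2 V)} {e : Sym2 V}
    (h : E ⊆ E') (hc : copyAt H E e) : copyAt H E' e := by
  obtain ⟨φ, h1, h2⟩ := hc
  exact ⟨φ, fun a b hab => h (h1 a b hab), h2⟩

/-- `e` lies in a copy of a member of the family inside `E`. -/
def cp (Hs : ∀ i, SimpleGraph (β i)) (E : Finset (Sym2 (Fin n))) (e : Sym2 (Fin n)) : Prop :=
  ∃ i, copyAt (Hs i) (↑E) e

lemma cp_mono {Hs : ∀ i, SimpleGraph (β i)} {E E' : Finset (Sym2 (Fin n))} {e : Sym2 (Fin n)}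
    (h : E ⊆ E') (hc : cp Hs E e) : cp Hs E' e := by
  obtain ⟨i, hi⟩ := hc
  exact ⟨i, copyAt_mono (by exact_mod_cast h) hi⟩

lemma mem_removableFam {Hs : ∀ i, SimpleGraph (β i)} {E : Finset (Sym2 (Fin n))}
    {e : Sym2 (Fin n)} : e ∈ removableFam Hs E ↔ e ∈ E ∧ cp Hs E e := by
  simp [removableFam, cp]

open Classical in
/-- number of edges kept when the edges of the list are considered in order for removal. -/
noncomputable def kM (Hs : ∀ i, SimpleGraph (β i)) : List (Sym2 (Fin n)) → ℕ
  | [] => 0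
  | e :: l => kM Hs l + if cp Hs (insert e l.toFinset) e then 0 else 1

open Classical in
noncomputable def procL (Hs : ∀ i, SimpleGraph (β i)) :
    Finset (Sym2 (Fin n)) → List (Sym2 (Fin n)) → Finset (Sym2 (Fin n))
  | E, [] => E
  | E, e :: l => procL Hs (if e ∈ removableFam Hs E then E.erase e else E) l

noncomputable def Er (Hs : ∀ i, SimpleGraph (β i)) (fuel : ℕ) (E : Finset (Sym2 (Fin n)))
    (g : Finset (Sym2 (Fin n)) → ℝ) : ℝ :=
  ∑ s, (reverseIterFam Hs fuel E s).toReal * g s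

lemma sum_pure {γ : Type*} [Fintype γ] (a : γ) (g : γ → ℝ) :
    ∑ s, ((PMF.pure a) s).toReal * g s = g a := by
  classical
  rw [Finset.sum_eq_single a]
  · simp
  · intro b _ hb
    simp [PMF.pure_apply, hb]
  · simp

lemma Er_zero (Hs : ∀ i, SimpleGraph (β i)) (E : Finset (Sym2 (Fin n)))
    (g : Finset (Sym2 (Fin n)) → ℝ) : Er Hs 0 E g = g E := by
  simp only [Er, reverseIterFam]
  exact sum_pure _ _

lemma Er_empty (Hs : ∀ i, SimpleGraph (β i)) (fuel : ℕ) (E : Finset (Sym2 (Fin n)))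
    (g : Finset (Sym2 (Fin n)) → ℝ) (h : removableFam Hs E = ∅) : Er Hs fuel E g = g E := by
  cases fuel with
  | zero => exact Er_zero _ _ _
  | succ k =>
    simp only [Er, reverseIterFam]
    rw [dif_neg (by simp [h])]
    exact sum_pure _ _

lemma Er_succ (Hs : ∀ i, SimpleGraph (β i)) (fuel : ℕ) (E : Finset (Sym2 (Fin n)))
    (g : Finset (Sym2 (Fin n)) → ℝ) (h : (removableFam Hs E).Nonempty) :
    ((removableFam Hs E).card : ℝ) * Er Hs (fuel+1) E g =
      ∑ e ∈ removableFam Hs E, Er Hs fuel (E.erase e) g := by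
  have hc : ((removableFam Hs E).card : ℝ) ≠ 0 := by
    have := h.card_pos
    positivity
  simp only [Er, reverseIterFam]
  rw [dif_pos h, Finset.sum_comm, Finset.mul_sum]
  refine Finset.sum_congr rfl fun s _ => ?_
  rw [PMF.bind_apply, tsum_fintype, ENNReal.toReal_sum, ← Finset.sum_mul, ← mul_assoc]
  · congr 1
    rw [Finset.mul_sum]
    rw [← Finset.sum_subset (Finset.subset_univ (removableFam Hs E))]
    · refine Finset.sum_congr rfl fun e he => ?_
      rw [PMF.uniformOfFinset_apply_of_mem h he, ENNReal.toReal_mul]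
      simp
      field_simp
    · intro e _ he
      rw [PMF.uniformOfFinset_apply_of_notMem h he]
      simp
  · intro a _
    exact ENNReal.mul_ne_top (PMF.apply_ne_top _ _) (PMF.apply_ne_top _ _)

lemma Er_eq (Hs : ∀ i, SimpleGraph (β i)) (g : Finset (Sym2 (Fin n)) → ℝ) :
    ∀ (k fuel : ℕ) (S E : Finset (Sym2 (Fin n))), S.card = k → k ≤ fuel →
      removableFam Hs E ⊆ S → Er Hs fuel E g = PE k S (fun l => g (procL Hs E l))
  | 0, fuel, S, E, hS, hf, hR => by
    rw [Finset.card_eq_zero] at hS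
    subst hS
    rw [Er_empty Hs fuel E g (Finset.subset_empty.1 hR)]
    rfl
  | k+1, fuel, S, E, hS, hf, hR => by
    classical
    obtain ⟨fuel, rfl⟩ : ∃ f, fuel = f + 1 := ⟨fuel - 1, by omega⟩
    have hS0 : (S.card : ℝ) ≠ 0 := by rw [hS]; positivity
    rw [PE, eq_div_iff hS0]
    have h1 : ∀ e ∈ S, PE k (S.erase e) (fun l => g (procL Hs E (e :: l))) =
        if e ∈ removableFam Hs E then Er Hs fuel (E.erase e) g else Er Hs (fuel+1) E g := by
      intro e he
      have hc : (S.erase e).card = k := by rw [Finset.card_erase_of_mem he]; omega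
      split_ifs with h
      · rw [Er_eq Hs g k fuel (S.erase e) (E.erase e) hc (by omega)]
        · simp only [procL, if_pos h]
        · intro x hx
          rw [mem_removableFam] at hx
          refine Finset.mem_erase.2 ⟨(Finset.mem_erase.1 hx.1).1, hR ?_⟩
          exact mem_removableFam.2 ⟨Finset.mem_of_mem_erase hx.1,
            cp_mono (Finset.erase_subset _ _) hx.2⟩
      · rw [Er_eq Hs g k (fuel+1) (S.erase e) E hc (by omega)]
        · simp only [procL, if_neg h]
        · intro x hx
          refine Finset.mem_erase.2 ⟨?_, hR hx⟩
          rintro rfl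
          exact h hx
    rw [Finset.sum_congr rfl h1, Finset.sum_ite, Finset.filter_mem_eq_inter,
      Finset.inter_eq_right.2 hR, Finset.filter_not, Finset.filter_mem_eq_inter,
      Finset.inter_eq_right.2 hR, Finset.sum_const, Finset.card_sdiff_of_subset hR,
      nsmul_eq_mul, Nat.cast_sub (Finset.card_le_card hR)]
    rcases (removableFam Hs E).eq_empty_or_nonempty with h0 | h0
    · rw [h0]; simp; ring
    · rw [← Er_succ Hs fuel E g h0]; ring

lemma procL_card (Hs : ∀ i, SimpleGraph (β i)) : ∀ (l : List (Sym2 (Fin n)))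
    (K E : Finset (Sym2 (Fin n))), l.Nodup → Disjoint K l.toFinset → E = K ∪ l.toFinset →
    (∀ e ∈ K, ¬ cp Hs E e) → (procL Hs E l).card = K.card + kM Hs l
  | [], K, E, hl, hd, hE, hK => by simp [procL, kM, hE]
  | e :: l, K, E, hl, hd, hE, hK => by
    classical
    have hel : e ∉ l := (List.nodup_cons.1 hl).1
    have hl' := (List.nodup_cons.1 hl).2
    rw [List.toFinset_cons] at hd hE
    rw [Finset.disjoint_insert_right] at hd
    have hiff : e ∈ removableFam Hs E ↔ cp Hs (insert e l.toFinset) e := by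
      rw [mem_removableFam]
      constructor
      · rintro ⟨_, i, φ, h1, h2⟩
        refine ⟨i, φ, fun a b hab => ?_, h2⟩
        have hE' := h1 a b hab
        have hnot : s(φ a, φ b) ∉ K := fun hk => hK _ hk ⟨i, φ, h1, a, b, hab, rfl⟩
        rw [hE] at hE'
        have hE3x := Finset.mem_union.1 (Finset.mem_coe.1 hE')
        exact Finset.mem_coe.2 (hE3x.resolve_left hnot)
      · intro h
        refine ⟨by rw [hE]; simp, cp_mono (by rw [hE]; exact Finset.subset_union_right) h⟩
    simp only [procL, kM]
    by_cases h : e ∈ removableFam Hs E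
    · rw [if_pos h, if_pos (hiff.1 h)]
      rw [procL_card Hs l K (E.erase e) hl' hd.2]
      · rfl
      · rw [hE]
        ext x
        simp only [Finset.mem_erase, Finset.mem_union, Finset.mem_insert, List.mem_toFinset]
        constructor
        · tauto
        · rintro (hx | hx)
          · exact ⟨fun h => hd.1 (h ▸ hx), Or.inl hx⟩
          · exact ⟨fun h => hel (h ▸ hx), Or.inr (Or.inr hx)⟩
      · intro x hx hc
        exact hK x hx (cp_mono (Finset.erase_subset _ _) hc)
    · rw [if_neg h, if_neg (fun h' => h (hiff.2 h'))]
      rw [procL_card Hs l (insert e K) E hl']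
      · rw [Finset.card_insert_of_notMem hd.1]; omega
      · rw [Finset.disjoint_insert_left]
        exact ⟨by simpa using hel, hd.2⟩
      · rw [hE]; ext x; simp
      · intro x hx
        rcases Finset.mem_insert.1 hx with rfl | hx
        · intro hc
          refine h (mem_removableFam.2 ⟨?_, hc⟩)
          rw [hE]; simp
        · exact hK x hx

lemma law_card (Hs : ∀ i, SimpleGraph (β i)) (n : ℕ) (h : ℕ → ℝ) :
    ∑ s, (reverseFinalFam Hs n s).toReal * h s.card =
      PE (allEdges n).card (allEdges n) (fun l => h (kM Hs l)) := by
  have := Er_eq Hs (fun s => h s.card) (allEdges n).card (allEdges n).card (allEdges n)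
    (allEdges n) rfl le_rfl (fun x hx => (mem_removableFam.1 hx).1)
  rw [Er] at this
  rw [reverseFinalFam, this]
  refine PE_congr _ _ _ _ fun l hl => ?_
  have hE : l.toFinset = allEdges n := by
    apply Finset.eq_of_subset_of_card_le
    · intro x hx
      exact hl.2.2 x (List.mem_toFinset.1 hx)
    · rw [List.toFinset_card_of_nodup hl.1, hl.2.1]
  rw [procL_card Hs l ∅ (allEdges n) hl.1 (by simp) (by simp [hE]) (by simp)]
  simp

lemma expEdges_eq (Hs : ∀ i, SimpleGraph (β i)) (n : ℕ) :
    expEdges (reverseFinalFam Hs n) =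
      PE (allEdges n).card (allEdges n) (fun l => (kM Hs l : ℝ)) := by
  rw [expEdges, tsum_fintype]
  exact law_card Hs n (fun k => (k:ℝ))

open Classical in
lemma prOf_ge (Hs : ∀ i, SimpleGraph (β i)) (n : ℕ) (Q : ℝ → Prop) (ε : ℝ)
    (h : PE (allEdges n).card (allEdges n)
      (fun l => if Q (kM Hs l) then (0:ℝ) else 1) ≤ ε) :
    ENNReal.ofReal (1 - ε) ≤ prOf (reverseFinalFam Hs n) {s | Q (s.card : ℝ)} := by
  have h1 := law_card Hs n (fun k => if Q k then (1:ℝ) else 0)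
  have h2 : PE (allEdges n).card (allEdges n) (fun l => if Q (kM Hs l) then (1:ℝ) else 0) =
      1 - PE (allEdges n).card (allEdges n) (fun l => if Q (kM Hs l) then (0:ℝ) else 1) := by
    rw [eq_sub_iff_add_eq, ← PE_add]
    refine Eq.trans ?_ (PE_const (allEdges n).card (allEdges n) 1 le_rfl)
    congr 1
    funext l
    split_ifs <;> simp
  apply ENNReal.ofReal_le_of_le_toReal
  rw [prOf, tsum_fintype, ENNReal.toReal_sum (fun _ _ => PMF.apply_ne_top _ _)]
  have h3 : ∑ a : ↑{s : Finset (Sym2 (Fin n)) | Q (s.card:ℝ)},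
      (reverseFinalFam Hs n a).toReal =
      ∑ s, (reverseFinalFam Hs n s).toReal * (if Q (s.card : ℝ) then (1:ℝ) else 0) := by
    simp only [mul_ite, mul_one, mul_zero]
    rw [← Finset.sum_filter]
    exact (Finset.sum_subtype _ (by simp) (fun s => (reverseFinalFam Hs n s).toReal)).symm
  rw [h3, h1, h2]
  linarith

end Proc
section Graph

open Classical in
noncomputable def JJ {γ : Type*} [Fintype γ] (H : SimpleGraph γ) (a b : γ) : Finset (Sym2 γ) :=
  (Finset.univ.filter (fun e => e ∈ H.edgeSet)).erase s(a, b)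

open Classical in
noncomputable def oS {γ : Type*} [Fintype γ] (a b : γ) (S : Finset (Sym2 γ)) : Finset γ :=
  Finset.univ.filter (fun x => x ≠ a ∧ x ≠ b ∧ ∃ f ∈ S, x ∈ f)

variable {γ : Type*} [Fintype γ] {H : SimpleGraph γ} {a b : γ}

lemma mem_JJ {f : Sym2 γ} : f ∈ JJ H a b ↔ f ≠ s(a,b) ∧ f ∈ H.edgeSet := by
  simp [JJ]

lemma mem_oS {S : Finset (Sym2 γ)} {x : γ} :
    x ∈ oS a b S ↔ x ≠ a ∧ x ≠ b ∧ ∃ f ∈ S, x ∈ f := by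
  simp [oS]

lemma JJ_card (hab : H.Adj a b) : (JJ H a b).card + 1 = H.edgeSet.ncard := by
  classical
  rw [JJ, Finset.card_erase_add_one (by simpa using hab), ← Set.ncard_coe_finset]
  congr 1
  ext; simp

lemma oS_nonempty {S : Finset (Sym2 γ)} (hS : S ⊆ JJ H a b) (hne : S.Nonempty) :
    (oS a b S).Nonempty := by
  obtain ⟨f, hf⟩ := hne
  obtain ⟨h1, h2⟩ := mem_JJ.1 (hS hf)
  induction f using Sym2.ind with
  | _ x y =>
    have hxy : x ≠ y := H.ne_of_adj h2
    by_cases hx : x ≠ a ∧ x ≠ b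
    · exact ⟨x, mem_oS.2 ⟨hx.1, hx.2, _, hf, Sym2.mem_mk_left _ _⟩⟩
    by_cases hy : y ≠ a ∧ y ≠ b
    · exact ⟨y, mem_oS.2 ⟨hy.1, hy.2, _, hf, Sym2.mem_mk_right _ _⟩⟩
    exfalso
    apply h1
    rw [Sym2.eq_iff]
    by_cases e1 : x = a <;> by_cases e2 : x = b <;> by_cases e3 : y = a <;> by_cases e4 : y = b <;>
      simp_all

lemma oS_card_le (S : Finset (Sym2 γ)) : (oS a b S).card ≤ 2 * S.card := by
  classical
  have : oS a b S ⊆ S.biUnion (fun f => f.toFinset) := by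
    intro x hx
    obtain ⟨_, _, f, hf, hxf⟩ := mem_oS.1 hx
    exact Finset.mem_biUnion.2 ⟨f, hf, by simpa using hxf⟩
  refine (Finset.card_le_card this).trans ?_
  rw [mul_comm]
  refine Finset.card_biUnion_le_card_mul _ _ _ fun f _ => ?_
  induction f using Sym2.ind with
  | _ x y =>
    rw [Sym2.toFinset_mk_eq]
    exact Finset.card_le_two

lemma card_ge_three (h : TwoBalanced H) (hab : H.Adj a b) :
    3 ≤ Fintype.card γ ∧ (JJ H a b).Nonempty := by
  classical
  have h1 := JJ_card hab
  have h2 := h.1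
  have hne : (JJ H a b).Nonempty := Finset.card_pos.1 (by omega)
  refine ⟨?_, hne⟩
  obtain ⟨x, hx⟩ := oS_nonempty (Finset.Subset.refl _) hne
  obtain ⟨h3, h4, _⟩ := mem_oS.1 hx
  have : ({a, b, x} : Finset γ).card = 3 := by
    rw [Finset.card_eq_three]
    exact ⟨a, b, x, H.ne_of_adj hab, h3.symm, h4.symm, rfl⟩
  rw [← this]
  exact Finset.card_le_univ _

lemma d2_mul (h : TwoBalanced H) (hab : H.Adj a b) :
    ((JJ H a b).card : ℝ) = d2 H * ((Fintype.card γ : ℝ) - 2) := by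
  have h1 := JJ_card hab
  have h2 := (card_ge_three h hab).1
  have h3 : (3:ℝ) ≤ Fintype.card γ := by exact_mod_cast h2
  rw [d2, div_mul_cancel₀ _ (by linarith), ← h1]
  push_cast; ring

lemma exists_adj (h : TwoBalanced H) : ∃ a b, H.Adj a b := by
  have : H.edgeSet.Nonempty := by
    rw [← Set.ncard_pos]; have := h.1; omega
  obtain ⟨f, hf⟩ := this
  induction f using Sym2.ind with
  | _ x y => exact ⟨x, y, hf⟩

lemma d2_pos (h : TwoBalanced H) : 0 < d2 H := by
  obtain ⟨a, b, hab⟩ := exists_adj h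
  have h2 : (3:ℝ) ≤ Fintype.card γ := by exact_mod_cast (card_ge_three h hab).1
  have h3 : (2:ℝ) ≤ H.edgeSet.ncard := by exact_mod_cast h.1
  rw [d2]
  apply div_pos <;> linarith

lemma bal (h : TwoBalanced H) (hab : H.Adj a b) (S : Finset (Sym2 γ)) (hS : S ⊆ JJ H a b) :
    (S.card : ℝ) ≤ d2 H * (oS a b S).card := by
  classical
  rcases S.eq_empty_or_nonempty with rfl | hne
  · simpa using mul_nonneg (d2_pos h).le (Nat.cast_nonneg _)
  have ho := oS_nonempty hS hne
  have hmem : ∀ x y, s(x,y) ∈ insert s(a,b) S → H.Adj x y := by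
    intro x y hxy
    rcases Finset.mem_insert.1 hxy with h | h
    · rw [← SimpleGraph.mem_edgeSet, h]; exact hab
    · exact (mem_JJ.1 (hS h)).2
  let G : H.Subgraph :=
    { verts := {x | x = a ∨ x = b ∨ x ∈ oS a b S}
      Adj := fun x y => s(x,y) ∈ insert s(a,b) S
      adj_sub := fun {x y} hxy => hmem x y hxy
      edge_vert := by
        intro x y hxy
        rcases Finset.mem_insert.1 hxy with h | h
        · rw [Sym2.eq_iff] at h
          rcases h with h | h
          · exact Or.inl h.1
          · exact Or.inr (Or.inl h.1)
        · by_cases h1 : x = a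
          · exact Or.inl h1
          by_cases h2 : x = b
          · exact Or.inr (Or.inl h2)
          exact Or.inr (Or.inr (mem_oS.2 ⟨h1, h2, _, h, Sym2.mem_mk_left _ _⟩))
      symm := by
        refine ⟨fun x y hxy => ?_⟩
        rw [Sym2.eq_swap (a := y)]; exact hxy }
  have hV : G.verts = ↑(insert a (insert b (oS a b S))) := by
    ext x; simp [G]
  have hVc : G.verts.ncard = (oS a b S).card + 2 := by
    rw [hV, Set.ncard_coe_finset, Finset.card_insert_of_notMem, Finset.card_insert_of_notMem]
    · intro hh; exact (mem_oS.1 hh).2.1 rfl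
    · intro hh
      rcases Finset.mem_insert.1 hh with hh | hh
      · exact H.ne_of_adj hab hh
      · exact (mem_oS.1 hh).1 rfl
  have hE : G.edgeSet = ↑(insert s(a,b) S) := by
    ext f
    induction f using Sym2.ind with
    | _ x y => rw [SimpleGraph.Subgraph.mem_edgeSet]; rfl
  have hEc : G.edgeSet.ncard = S.card + 1 := by
    rw [hE, Set.ncard_coe_finset, Finset.card_insert_of_notMem]
    intro hh
    exact (mem_JJ.1 (hS hh)).1 rfl
  have ho' := ho.card_pos
  have key : ((G.edgeSet.ncard : ℝ) - 1) / ((G.verts.ncard : ℝ) - 2) ≤ d2 H := by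
    by_cases hG : G = ⊤
    · apply le_of_eq
      rw [d2, hG]
      simp [Set.ncard_univ]
    · exact h.2 G hG (by omega)
  rw [hVc, hEc] at key
  push_cast at key
  rw [div_le_iff₀] at key
  · linarith
  · have : (0:ℝ) < (oS a b S).card := by exact_mod_cast ho'
    linarith

lemma two_le (h : TwoBalanced H) : 1 / 2 ≤ d2 H := by
  obtain ⟨a, b, hab⟩ := exists_adj h
  have h1 := bal h hab _ (Finset.Subset.refl _)
  have h2 := d2_mul h hab
  have h3 := d2_pos h
  have h4 : ((oS a b (JJ H a b)).card : ℝ) ≤ 2 * (JJ H a b).card := by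
    exact_mod_cast oS_card_le _
  have h5 : ((Fintype.card γ : ℝ) - 2) ≤ (oS a b (JJ H a b)).card := by
    rw [h2] at h1
    exact le_of_mul_le_mul_left h1 h3
  have h6 : 0 < ((JJ H a b).card : ℝ) := by
    exact_mod_cast (card_ge_three h hab).2.card_pos
  by_contra hlt
  push Not at hlt
  nlinarith

open Classical in
lemma count_le {n : ℕ} (hab : a ≠ b) (O : Finset γ) (ha : a ∉ O) (hb : b ∉ O)
    (W : Finset (Fin n)) (x y : Fin n) :
    (Finset.univ.filter (fun φ : γ → Fin n => φ a = x ∧ φ b = y ∧ ∀ z ∈ O, φ z ∈ W)).card ≤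
      W.card ^ O.card * n ^ (Fintype.card γ - 2 - O.card) := by
  let t : γ → Finset (Fin n) := fun z =>
    if z = a then {x} else if z = b then {y} else if z ∈ O then W else Finset.univ
  have hsub : Finset.univ.filter (fun φ : γ → Fin n => φ a = x ∧ φ b = y ∧ ∀ z ∈ O, φ z ∈ W) ⊆
      Fintype.piFinset t := by
    intro φ hφ
    simp only [Finset.mem_filter, Finset.mem_univ, true_and] at hφ
    rw [Fintype.mem_piFinset]
    intro z
    simp only [t]
    split_ifs with h1 h2 h3
    · simp [h1, hφ.1]
    · simp [h2, hφ.2.1]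
    · exact hφ.2.2 z h3
    · simp
  refine (Finset.card_le_card hsub).trans (le_of_eq ?_)
  rw [Fintype.card_piFinset]
  have ht : ∀ z, (t z).card = (if z ∈ O then W.card else 1) *
      (if z ∉ insert a (insert b O) then n else 1) := by
    intro z
    simp only [t, Finset.mem_insert]
    by_cases h1 : z = a
    · subst h1; simp [ha]
    by_cases h2 : z = b
    · subst h2; simp [hb, h1]
    by_cases h3 : z ∈ O
    · simp [h1, h2, h3]
    · simp [h1, h2, h3]
  rw [Finset.prod_congr rfl (fun z _ => ht z), Finset.prod_mul_distrib]
  rw [Finset.prod_ite, Finset.prod_ite]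
  simp only [Finset.prod_const, one_pow, mul_one]
  congr 2
  · congr 1; ext z; simp
  · have : Finset.univ.filter (fun z => z ∉ insert a (insert b O)) =
        (insert a (insert b O))ᶜ := by ext z; simp
    rw [this, Finset.card_compl, Finset.card_insert_of_notMem (by simp [hab, ha]),
      Finset.card_insert_of_notMem hb]
    omega

open Classical in
lemma F2i {n : ℕ} (hn : 1 ≤ n) (h : TwoBalanced H) (hab : H.Adj a b) (d : ℝ) (hd : 0 < d)
    (hdH : d ≤ d2 H) (p lam : ℝ) (hp : 0 ≤ p) (hlam : 0 ≤ lam)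
    (hpl : p ≤ lam * (n:ℝ) ^ (-(1/d))) (x y : Fin n) (U : Finset (Sym2 (Fin n))) :
    ∑ φ ∈ Finset.univ.filter (fun φ : γ → Fin n => Function.Injective φ ∧ φ a = x ∧ φ b = y),
      p ^ ((JJ H a b).image (Sym2.map φ) \ U).card ≤
    ∑ S ∈ (JJ H a b).powerset, lam ^ ((JJ H a b).card - S.card) *
      (2 * U.card : ℝ) ^ (oS a b S).card := by
  set J := JJ H a b with hJ
  set Φ := Finset.univ.filter
    (fun φ : γ → Fin n => Function.Injective φ ∧ φ a = x ∧ φ b = y) with hΦ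
  have h1 : ∀ φ ∈ Φ, p ^ (J.image (Sym2.map φ) \ U).card ≤
      ∑ S ∈ J.powerset, if ∀ f ∈ S, Sym2.map φ f ∈ U then p ^ (J.card - S.card) else 0 := by
    intro φ hφ
    have hinj : Function.Injective φ := (Finset.mem_filter.1 hφ).2.1
    set S0 := J.filter (fun f => Sym2.map φ f ∈ U) with hS0
    have hcard : (J.image (Sym2.map φ) \ U).card = J.card - S0.card := by
      have : J.image (Sym2.map φ) \ U = (J \ S0).image (Sym2.map φ) := by
        ext g
        simp only [Finset.mem_sdiff, Finset.mem_image, hS0, Finset.mem_filter]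
        constructor
        · rintro ⟨⟨f, hf, rfl⟩, hU⟩
          exact ⟨f, ⟨hf, fun hh => hU hh.2⟩, rfl⟩
        · rintro ⟨f, ⟨hf, hh⟩, rfl⟩
          exact ⟨⟨f, hf, rfl⟩, fun hU => hh ⟨hf, hU⟩⟩
      rw [this, Finset.card_image_of_injective _ (Sym2.map.injective hinj),
        Finset.card_sdiff_of_subset (Finset.filter_subset _ _)]
    rw [hcard]
    have hS0J : S0 ∈ J.powerset := Finset.mem_powerset.2 (Finset.filter_subset _ _)
    have hnn : ∀ S ∈ J.powerset,
        0 ≤ (if ∀ f ∈ S, Sym2.map φ f ∈ U then p ^ (J.card - S.card) else 0) := by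
      intro S _
      split_ifs
      · exact pow_nonneg hp _
      · exact le_rfl
    have hs := Finset.single_le_sum hnn hS0J
    have hc : ∀ f ∈ S0, Sym2.map φ f ∈ U := fun f hf => (Finset.mem_filter.1 hf).2
    rw [if_pos hc] at hs
    exact hs
  refine (Finset.sum_le_sum h1).trans ?_
  rw [Finset.sum_comm]
  refine Finset.sum_le_sum fun S hS => ?_
  rw [Finset.mem_powerset] at hS
  rw [← Finset.sum_filter, Finset.sum_const, nsmul_eq_mul]
  set W : Finset (Fin n) := U.biUnion (fun f => f.toFinset) with hW
  have hWc : W.card ≤ 2 * U.card := by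
    rw [mul_comm]
    refine Finset.card_biUnion_le_card_mul _ _ _ fun f _ => ?_
    induction f using Sym2.ind with
    | _ x y =>
      rw [Sym2.toFinset_mk_eq]
      exact Finset.card_le_two
  have hcnt : (Φ.filter (fun φ => ∀ f ∈ S, Sym2.map φ f ∈ U)).card ≤
      W.card ^ (oS a b S).card * n ^ (Fintype.card γ - 2 - (oS a b S).card) := by
    refine le_trans (Finset.card_le_card ?_) (count_le (H.ne_of_adj hab) (oS a b S)
      (fun hh => (mem_oS.1 hh).1 rfl) (fun hh => (mem_oS.1 hh).2.1 rfl) W x y)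
    intro φ hφ
    simp only [hΦ, Finset.mem_filter, Finset.mem_univ, true_and] at hφ ⊢
    refine ⟨hφ.1.2.1, hφ.1.2.2, fun z hz => ?_⟩
    obtain ⟨_, _, f, hf, hzf⟩ := mem_oS.1 hz
    refine Finset.mem_biUnion.2 ⟨_, hφ.2 f hf, ?_⟩
    rw [Sym2.mem_toFinset]
    exact Sym2.mem_map.2 ⟨z, hzf, rfl⟩
  have hoc : (oS a b S).card + 2 ≤ Fintype.card γ := by
    have : oS a b S ⊆ ({a, b} : Finset γ)ᶜ := by
      intro z hz
      obtain ⟨h1, h2, _⟩ := mem_oS.1 hz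
      simp [h1, h2]
    have := Finset.card_le_card this
    rw [Finset.card_compl, Finset.card_pair (H.ne_of_adj hab)] at this
    have := (card_ge_three h hab).1
    omega
  have hSJ := Finset.card_le_card hS
  have hn1 : (1:ℝ) ≤ n := by exact_mod_cast hn
  have hn0 : (0:ℝ) < n := by linarith
  have hexp : ((Fintype.card γ - 2 - (oS a b S).card : ℕ) : ℝ) +
      (-(1/d)) * ((J.card - S.card : ℕ) : ℝ) ≤ 0 := by
    rw [Nat.cast_sub hSJ, Nat.cast_sub (by omega), Nat.cast_sub (by omega)]
    have e1 := bal h hab S hS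
    have e2 := d2_mul h hab
    have e3 : (0:ℝ) ≤ (Fintype.card γ : ℝ) - 2 - (oS a b S).card := by
      have : ((oS a b S).card + 2 : ℝ) ≤ Fintype.card γ := by exact_mod_cast hoc
      linarith
    have e4 : d * ((Fintype.card γ : ℝ) - 2 - (oS a b S).card) ≤ J.card - S.card := by
      have := mul_le_mul_of_nonneg_right hdH e3
      rw [hJ, e2]
      linarith
    have e5 : (Fintype.card γ : ℝ) - 2 - (oS a b S).card ≤ (J.card - S.card) / d := by
      rw [le_div_iff₀ hd]; linarith
    have e6 : -(1/d) * ((J.card:ℝ) - S.card) = - ((J.card - S.card) / d) := by ring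
    rw [e6]
    push_cast
    linarith
  calc ((Φ.filter (fun φ => ∀ f ∈ S, Sym2.map φ f ∈ U)).card : ℝ) * p ^ (J.card - S.card)
      ≤ ((2 * U.card : ℝ) ^ (oS a b S).card * (n:ℝ) ^ (Fintype.card γ - 2 - (oS a b S).card)) *
        (lam * (n:ℝ) ^ (-(1/d))) ^ (J.card - S.card) := by
        refine mul_le_mul ?_ (pow_le_pow_left₀ hp hpl _) (by positivity) (by positivity)
        refine le_trans (Nat.cast_le.2 hcnt) ?_
        push_cast
        refine mul_le_mul_of_nonneg_right (pow_le_pow_left₀ (by positivity) ?_ _) (by positivity)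
        exact_mod_cast hWc
    _ = lam ^ (J.card - S.card) * (2 * U.card : ℝ) ^ (oS a b S).card *
        (n:ℝ) ^ (((Fintype.card γ - 2 - (oS a b S).card : ℕ) : ℝ) +
          (-(1/d)) * ((J.card - S.card : ℕ) : ℝ)) := by
        rw [Real.rpow_add hn0, Real.rpow_natCast, Real.rpow_mul hn0.le, Real.rpow_natCast,
          mul_pow]
        ring
    _ ≤ lam ^ (J.card - S.card) * (2 * U.card : ℝ) ^ (oS a b S).card * 1 := by
        refine mul_le_mul_of_nonneg_left ?_ (by positivity)
        exact Real.rpow_le_one_of_one_le_of_nonpos hn1 hexp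
    _ = _ := mul_one _

end Graph
section Cops
variable {r : ℕ} {β : Fin r → Type*} [∀ i, Fintype (β i)] {n : ℕ}

open Classical in
noncomputable def Cps (Hs : ∀ i, SimpleGraph (β i)) (x y : Fin n) :
    Finset (Σ i, β i × β i × (β i → Fin n)) :=
  Finset.univ.filter (fun t => (Hs t.1).Adj t.2.1 t.2.2.1 ∧
    (Function.Injective t.2.2.2 ∧ t.2.2.2 t.2.1 = x ∧ t.2.2.2 t.2.2.1 = y))

noncomputable def Tt (Hs : ∀ i, SimpleGraph (β i)) (t : Σ i, β i × β i × (β i → Fin n)) :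
    Finset (Sym2 (Fin n)) :=
  (JJ (Hs t.1) t.2.1 t.2.2.1).image (Sym2.map t.2.2.2)

lemma cp_iff (Hs : ∀ i, SimpleGraph (β i)) (x y : Fin n) (E : Finset (Sym2 (Fin n))) :
    cp Hs (insert s(x,y) E) s(x,y) ↔ ∃ t ∈ Cps Hs x y, Tt Hs t ⊆ E := by
  classical
  constructor
  · rintro ⟨i, φ, h1, a, b, hab, he⟩
    have key : ∀ a b, (Hs i).Adj a b → x = φ a → y = φ b →
        ∃ t ∈ Cps Hs x y, Tt Hs t ⊆ E := by
      intro a b hab hx hy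
      refine ⟨⟨i, a, b, φ⟩, ?_, ?_⟩
      · simp only [Cps, Finset.mem_filter, Finset.mem_univ, true_and]
        exact ⟨hab, φ.injective, hx.symm, hy.symm⟩
      · intro g hg
        obtain ⟨f, hf, rfl⟩ := Finset.mem_image.1 hg
        obtain ⟨h2, h3⟩ := mem_JJ.1 hf
        change Sym2.map φ f ∈ E
        have hne : Sym2.map φ f ≠ s(x,y) := by
          rw [hx, hy, ← Sym2.map_mk]
          intro hh
          exact h2 (Sym2.map.injective φ.injective hh)
        induction f using Sym2.ind with
        | _ u v =>
          have := h1 u v h3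
          rw [Finset.mem_coe, Finset.mem_insert] at this
          exact this.resolve_left hne
    rw [Sym2.eq_iff] at he
    rcases he with he | he
    · exact key a b hab he.1 he.2
    · exact key b a hab.symm he.1 he.2
  · rintro ⟨⟨i, a, b, φ⟩, ht, hT⟩
    simp only [Cps, Finset.mem_filter, Finset.mem_univ, true_and] at ht
    obtain ⟨hab, hinj, hx, hy⟩ := ht
    refine ⟨i, ⟨φ, hinj⟩, ?_, a, b, hab, by simp [hx, hy]⟩
    intro u v huv
    rw [Finset.mem_coe, Finset.mem_insert]
    by_cases h : s(u,v) = s(a,b)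
    · left
      have := congrArg (Sym2.map φ) h
      simp only [Sym2.map_mk, hx, hy] at this
      exact this
    · right
      apply hT
      exact Finset.mem_image.2 ⟨s(u,v), mem_JJ.2 ⟨h, huv⟩, rfl⟩

lemma Tt_sub (Hs : ∀ i, SimpleGraph (β i)) (x y : Fin n) (t) (ht : t ∈ Cps Hs x y) :
    Tt Hs t ⊆ (allEdges n).erase s(x,y) := by
  classical
  obtain ⟨i, a, b, φ⟩ := t
  simp only [Cps, Finset.mem_filter, Finset.mem_univ, true_and] at ht
  obtain ⟨hab, hinj, hx, hy⟩ := ht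
  intro g hg
  obtain ⟨f, hf, rfl⟩ := Finset.mem_image.1 hg
  obtain ⟨h2, h3⟩ := mem_JJ.1 hf
  refine Finset.mem_erase.2 ⟨?_, ?_⟩
  · change Sym2.map φ f ≠ _
    rw [← hx, ← hy, ← Sym2.map_mk]
    exact fun hh => h2 (Sym2.map.injective hinj hh)
  · simp only [allEdges, Finset.mem_filter, Finset.mem_univ, true_and]
    induction f using Sym2.ind with
    | _ u v =>
      intro hd
      have : φ u = φ v := hd
      exact (Hs i).ne_of_adj h3 (hinj this)

lemma Tt_card_le (Hs : ∀ i, SimpleGraph (β i)) (eJ : ℕ)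
    (he : ∀ i, (Hs i).edgeSet.ncard ≤ eJ) (x y : Fin n) (t) (ht : t ∈ Cps Hs x y) :
    (Tt Hs t).card + 1 ≤ eJ := by
  obtain ⟨i, a, b, φ⟩ := t
  simp only [Cps, Finset.mem_filter, Finset.mem_univ, true_and] at ht
  have h1 := JJ_card ht.1
  have h2 : (Tt Hs ⟨i, a, b, φ⟩).card ≤ (JJ (Hs i) a b).card := Finset.card_image_le
  have := he i
  omega

open Classical in
lemma Cps_sum_le (Hs : ∀ i, SimpleGraph (β i)) (x y : Fin n) (p C : ℝ) (hC : 0 ≤ C)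
    (U : Finset (Sym2 (Fin n)))
    (h : ∀ i a b, (Hs i).Adj a b →
      ∑ φ ∈ Finset.univ.filter
        (fun φ : β i → Fin n => Function.Injective φ ∧ φ a = x ∧ φ b = y),
      p ^ ((JJ (Hs i) a b).image (Sym2.map φ) \ U).card ≤ C) :
    ∑ t ∈ Cps Hs x y, p ^ (Tt Hs t \ U).card ≤ (∑ i, (Fintype.card (β i) : ℝ)^2) * C := by
  rw [Cps, Finset.sum_filter, Fintype.sum_sigma, Finset.sum_mul]
  refine Finset.sum_le_sum fun i _ => ?_
  rw [Fintype.sum_prod_type]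
  have : ∀ a : β i, ∀ b : β i, (∑ φ : β i → Fin n,
      if (Hs i).Adj a b ∧ (Function.Injective φ ∧ φ a = x ∧ φ b = y) then
        p ^ (Tt Hs ⟨i, a, b, φ⟩ \ U).card else 0) ≤ C := by
    intro a b
    by_cases hab : (Hs i).Adj a b
    · simp only [hab, true_and]
      rw [← Finset.sum_filter]
      exact h i a b hab
    · simpa [hab] using hC
  calc _ ≤ ∑ a : β i, ∑ b : β i, C := by
        refine Finset.sum_le_sum fun a _ => ?_
        rw [Fintype.sum_prod_type]
        exact Finset.sum_le_sum fun b _ => this a b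
    _ = _ := by simp; ring

/-- The constant `D0`. -/
noncomputable def D0 (β : Fin r → Type*) [∀ i, Fintype (β i)] : ℝ :=
  ∑ i, (Fintype.card (β i) : ℝ)^2

lemma D0_nonneg : 0 ≤ D0 β := Finset.sum_nonneg fun i _ => by positivity

lemma F2_small (Hs : ∀ i, SimpleGraph (β i)) (hHs : ∀ i, TwoBalanced (Hs i)) (hn : 1 ≤ n)
    (d : ℝ) (hd : 0 < d) (hdH : ∀ i, d ≤ d2 (Hs i)) (p lam : ℝ) (hp : 0 ≤ p) (hlam : 0 ≤ lam)
    (hlam1 : lam ≤ 1) (hpl : p ≤ lam * (n:ℝ) ^ (-(1/d))) (x y : Fin n) :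
    ∑ t ∈ Cps Hs x y, p ^ (Tt Hs t).card ≤ D0 β * lam := by
  classical
  have := Cps_sum_le Hs x y p lam hlam ∅ (fun i a b hab => by
    refine (F2i hn (hHs i) hab d hd (hdH i) p lam hp hlam hpl x y ∅).trans ?_
    rw [Finset.sum_eq_single ∅]
    · have h1 : (oS a b (∅ : Finset (Sym2 (β i)))).card = 0 := by
        have := oS_card_le (a := a) (b := b) (∅ : Finset (Sym2 (β i)))
        simpa using this
      rw [h1]
      have h2 := (card_ge_three (hHs i) hab).2.card_pos
      simp only [Finset.card_empty, pow_zero, mul_one, Nat.sub_zero]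
      exact pow_le_of_le_one hlam hlam1 (by omega)
    · intro S hS hne
      have := (oS_nonempty (Finset.mem_powerset.1 hS)
        (Finset.nonempty_iff_ne_empty.2 hne)).card_pos
      rw [Finset.card_empty, Nat.cast_zero, mul_zero, zero_pow (by omega), mul_zero]
    · intro hh
      exact absurd (Finset.empty_mem_powerset _) hh)
  simp only [Finset.sdiff_empty] at this
  exact this

lemma F2_big (Hs : ∀ i, SimpleGraph (β i)) (hHs : ∀ i, TwoBalanced (Hs i)) (hn : 1 ≤ n)
    (d : ℝ) (hd : 0 < d) (hdH : ∀ i, d ≤ d2 (Hs i)) (eJ : ℕ)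
    (he : ∀ i, (Hs i).edgeSet.ncard ≤ eJ) (p w : ℝ) (hp : 0 ≤ p) (hw : 1 ≤ w)
    (hpl : p ≤ w ^ 2 * (n:ℝ) ^ (-(1/d))) (x y : Fin n) (U : Finset (Sym2 (Fin n)))
    (hU : (2 * U.card : ℝ) ≤ w) :
    ∑ t ∈ Cps Hs x y, p ^ (Tt Hs t \ U).card ≤ D0 β * (2 ^ eJ * w ^ (2 * (eJ - 1))) := by
  classical
  refine Cps_sum_le Hs x y p _ (by positivity) U (fun i a b hab => ?_)
  refine (F2i hn (hHs i) hab d hd (hdH i) p (w^2) hp (by positivity) hpl x y U).trans ?_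
  have hJ : (JJ (Hs i) a b).card ≤ eJ - 1 := by
    have := JJ_card hab
    have := he i
    omega
  have h1 : ∀ S ∈ (JJ (Hs i) a b).powerset, (w^2) ^ ((JJ (Hs i) a b).card - S.card) *
      (2 * U.card : ℝ) ^ (oS a b S).card ≤ w ^ (2 * (eJ - 1)) := by
    intro S hS
    have hS' := Finset.card_le_card (Finset.mem_powerset.1 hS)
    calc _ ≤ (w^2) ^ ((JJ (Hs i) a b).card - S.card) * w ^ (2 * S.card) := by
          refine mul_le_mul_of_nonneg_left ?_ (by positivity)
          refine (pow_le_pow_left₀ (by positivity) hU _).trans ?_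
          exact pow_le_pow_right₀ hw (oS_card_le S)
      _ = w ^ (2 * (JJ (Hs i) a b).card) := by
          rw [← pow_mul, ← pow_add]; congr 1; omega
      _ ≤ _ := pow_le_pow_right₀ hw (by omega)
  refine (Finset.sum_le_card_nsmul _ _ _ h1).trans ?_
  rw [nsmul_eq_mul, Finset.card_powerset]
  refine mul_le_mul_of_nonneg_right ?_ (by positivity)
  push_cast
  exact pow_le_pow_right₀ (by norm_num) (by omega)

/-- number of copies through `s(x,y)` whose remaining edges lie in `E`. -/
noncomputable def Xc (Hs : ∀ i, SimpleGraph (β i)) (x y : Fin n) (E : Finset (Sym2 (Fin n))) : ℝ :=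
  ∑ t ∈ Cps Hs x y, if Tt Hs t ⊆ E then 1 else 0

lemma Xc_nonneg (Hs : ∀ i, SimpleGraph (β i)) (x y : Fin n) (E : Finset (Sym2 (Fin n))) :
    0 ≤ Xc Hs x y E := Finset.sum_nonneg fun t _ => by split_ifs <;> norm_num

lemma moment (Hs : ∀ i, SimpleGraph (β i)) (eJ : ℕ)
    (he : ∀ i, (Hs i).edgeSet.ncard ≤ eJ) (x y : Fin n) (m : ℕ) (hm : m ≤ (allEdges n).card)
    (B : ℝ) (u : ℕ) (hB : 0 ≤ B) (hBU : ∀ U : Finset (Sym2 (Fin n)), U.card ≤ u →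
      ∑ t ∈ Cps Hs x y, ((m:ℝ) / (allEdges n).card) ^ (Tt Hs t \ U).card ≤ B) :
    ∀ (k : ℕ) (U : Finset (Sym2 (Fin n))), U ⊆ allEdges n → U.card + k * eJ ≤ u →
    PE m (allEdges n) (fun l => (if U ⊆ l.toFinset then 1 else 0) * Xc Hs x y l.toFinset ^ k) ≤
      B ^ k * ((m:ℝ) / (allEdges n).card) ^ U.card
  | 0, U, hU, hk => by
    simpa using PE_subset m (allEdges n) U hU hm
  | k+1, U, hU, hk => by
    set p : ℝ := (m:ℝ) / (allEdges n).card with hp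
    have hp0 : 0 ≤ p := by positivity
    have h1 : ∀ l : List (Sym2 (Fin n)),
        (if U ⊆ l.toFinset then (1:ℝ) else 0) * Xc Hs x y l.toFinset ^ (k+1) =
        ∑ t ∈ Cps Hs x y, (if U ∪ Tt Hs t ⊆ l.toFinset then 1 else 0) *
          Xc Hs x y l.toFinset ^ k := by
      intro l
      rw [pow_succ, ← mul_assoc]
      nth_rewrite 2 [Xc]
      rw [Finset.mul_sum]
      refine Finset.sum_congr rfl fun t _ => ?_
      by_cases hA : U ⊆ l.toFinset <;> by_cases hB : Tt Hs t ⊆ l.toFinset <;>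
        simp [hA, hB, Finset.union_subset_iff]
    simp only [h1]
    rw [PE_sum]
    calc _ ≤ ∑ t ∈ Cps Hs x y, B ^ k * p ^ (U.card + (Tt Hs t \ U).card) := by
          refine Finset.sum_le_sum fun t ht => ?_
          have hc := Tt_card_le Hs eJ he x y t ht
          have hu : (U ∪ Tt Hs t).card = U.card + (Tt Hs t \ U).card := by
            rw [← Finset.union_sdiff_self_eq_union, Finset.card_union_of_disjoint
              Finset.disjoint_sdiff]
          have hle : (Tt Hs t \ U).card ≤ (Tt Hs t).card := Finset.card_le_card Finset.sdiff_subset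
          have := moment Hs eJ he x y m hm B u hB hBU k (U ∪ Tt Hs t)
            (Finset.union_subset hU ((Tt_sub Hs x y t ht).trans (Finset.erase_subset _ _)))
            (by rw [hu]; nlinarith)
          rw [hu] at this
          exact this
      _ = B ^ k * p ^ U.card * ∑ t ∈ Cps Hs x y, p ^ (Tt Hs t \ U).card := by
          rw [Finset.mul_sum]
          refine Finset.sum_congr rfl fun t _ => ?_
          rw [pow_add]; ring
      _ ≤ B ^ k * p ^ U.card * B := by
          refine mul_le_mul_of_nonneg_left (hBU U (by nlinarith)) (by positivity)
      _ = _ := by ring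

open Classical in
lemma Xc_tail (Hs : ∀ i, SimpleGraph (β i)) (eJ : ℕ)
    (he : ∀ i, (Hs i).edgeSet.ncard ≤ eJ) (x y : Fin n) (m : ℕ) (hm : m ≤ (allEdges n).card)
    (B : ℝ) (k : ℕ) (hB : 0 ≤ B) (hBU : ∀ U : Finset (Sym2 (Fin n)), U.card ≤ k * eJ →
      ∑ t ∈ Cps Hs x y, ((m:ℝ) / (allEdges n).card) ^ (Tt Hs t \ U).card ≤ B)
    (Del : ℝ) (hDel : 0 < Del) :
    PE m (allEdges n) (fun l => if Del < Xc Hs x y l.toFinset then 1 else 0) ≤ (B / Del) ^ k := by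
  have h := moment Hs eJ he x y m hm B (k * eJ) hB hBU k ∅ (by simp) (by simp)
  simp only [Finset.empty_subset, if_true, one_mul, Finset.card_empty, pow_zero, mul_one] at h
  rw [div_pow, div_eq_inv_mul]
  refine le_trans ?_ (mul_le_mul_of_nonneg_left h (by positivity))
  rw [← PE_mul]
  refine PE_mono _ _ _ _ fun l _ => ?_
  split_ifs with hl
  · rw [← div_eq_inv_mul, one_le_div (by positivity)]
    exact pow_le_pow_left₀ hDel.le hl.le _
  · have := Xc_nonneg Hs x y l.toFinset
    positivity

open Classical in
/-- indicator that the newest edge survives -/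
noncomputable def sv (Hs : ∀ i, SimpleGraph (β i)) : List (Sym2 (Fin n)) → ℝ
  | [] => 0
  | e :: l => if cp Hs (insert e l.toFinset) e then 0 else 1

lemma sv_nonneg (Hs : ∀ i, SimpleGraph (β i)) (l : List (Sym2 (Fin n))) : 0 ≤ sv Hs l := by
  cases l with
  | nil => exact le_rfl
  | cons e l => simp only [sv]; split_ifs <;> norm_num

lemma kM_split (Hs : ∀ i, SimpleGraph (β i)) : ∀ (j : ℕ) (l : List (Sym2 (Fin n))),
    (kM Hs l : ℝ) = kM Hs (l.drop j) + ∑ i ∈ Finset.range j, sv Hs (l.drop i)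
  | 0, l => by simp
  | j+1, [] => by simp [sv]
  | j+1, e :: l => by
    rw [Finset.sum_range_succ', List.drop_succ_cons]
    have := kM_split Hs j l
    simp only [List.drop_succ_cons, List.drop_zero]
    rw [kM, sv]
    push_cast
    rw [this]
    ring

lemma kM_le_length (Hs : ∀ i, SimpleGraph (β i)) : ∀ (l : List (Sym2 (Fin n))),
    kM Hs l ≤ l.length
  | [] => by simp [kM]
  | e :: l => by
    have := kM_le_length Hs l
    simp only [kM, List.length_cons]
    split_ifs <;> omega

lemma EM_eq (Hs : ∀ i, SimpleGraph (β i)) (N : ℕ) (S : Finset (Sym2 (Fin n))) (hN : N ≤ S.card) :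
    PE N S (fun l => (kM Hs l : ℝ)) = ∑ i ∈ Finset.range N, PE (i+1) S (sv Hs) := by
  rw [PE_congr N S _ (fun l => ∑ i ∈ Finset.range N, sv Hs (l.drop i))]
  · rw [PE_sum, ← Finset.sum_range_reflect]
    refine Finset.sum_congr rfl fun i hi => ?_
    rw [Finset.mem_range] at hi
    rw [← PE_drop (N - 1 - i) (i + 1) S (sv Hs) (by omega)]
    congr 1
    omega
  · intro l hl
    rw [kM_split Hs N l, List.drop_eq_nil_of_le (by rw [hl.2.1])]
    simp [kM]

lemma card_allEdges (n : ℕ) : (allEdges n).card = n.choose 2 := by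
  have : allEdges n = (⊤ : SimpleGraph (Fin n)).edgeFinset := by
    ext e
    simp only [allEdges, Finset.mem_filter, Finset.mem_univ, true_and,
      SimpleGraph.mem_edgeFinset, SimpleGraph.edgeSet_top]
    rfl
  rw [this, SimpleGraph.card_edgeFinset_top_eq_card_choose_two]
  simp

lemma sv_lower (Hs : ∀ i, SimpleGraph (β i)) (k : ℕ) (hk : k + 1 ≤ (allEdges n).card) (ε : ℝ)
    (h : ∀ x y : Fin n, ∑ t ∈ Cps Hs x y, ((k:ℝ) / ((allEdges n).card - 1)) ^ (Tt Hs t).card ≤ ε) :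
    1 - ε ≤ PE (k+1) (allEdges n) (sv Hs) := by
  classical
  have hN : (0:ℝ) < (allEdges n).card := by
    have : 0 < (allEdges n).card := by omega
    exact_mod_cast this
  rw [PE, le_div_iff₀ hN, mul_comm, ← nsmul_eq_mul]
  refine Finset.card_nsmul_le_sum _ _ _ fun e he => ?_
  induction e using Sym2.ind with
  | _ x y =>
    have hc : ((allEdges n).erase s(x,y)).card = (allEdges n).card - 1 :=
      Finset.card_erase_of_mem he
    have h1 : PE k ((allEdges n).erase s(x,y)) (fun l => 1 - ∑ t ∈ Cps Hs x y,
        if Tt Hs t ⊆ l.toFinset then (1:ℝ) else 0) ≤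
        PE k ((allEdges n).erase s(x,y)) (fun l => sv Hs (s(x,y) :: l)) := by
      refine PE_mono _ _ _ _ fun l _ => ?_
      simp only [sv]
      have hnn : ∀ t ∈ Cps Hs x y, 0 ≤ (if Tt Hs t ⊆ l.toFinset then (1:ℝ) else 0) := by
        intro t _; split_ifs <;> norm_num
      split_ifs with hcp
      · obtain ⟨t, ht, hT⟩ := (cp_iff Hs x y _).1 hcp
        have := Finset.single_le_sum hnn ht
        rw [if_pos hT] at this
        linarith
      · have := Finset.sum_nonneg hnn
        linarith
    refine le_trans ?_ h1
    rw [PE_sub, PE_const _ _ _ (by omega), PE_sum]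
    refine sub_le_sub_left (le_trans (Finset.sum_le_sum fun t ht => ?_) (h x y)) 1
    have := PE_subset k _ (Tt Hs t) (Tt_sub Hs x y t ht) (by omega)
    rw [hc, Nat.cast_sub (by omega)] at this
    simpa using this

end Cops
section Blocks
variable {E : Type*} [Fintype E]

lemma sum_fin_succ (m : ℕ) (F : (Fin (m+1) → E) → ℝ) :
    ∑ η, F η = ∑ e, ∑ η : Fin m → E, F (Fin.cons e η) := by
  rw [← Fintype.sum_prod_type']
  exact (Fintype.sum_equiv (Fin.consEquiv (fun _ => E)) _ _ (fun x => rfl)).symm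

lemma blk1 (u : E → ℝ) : ∀ m : ℕ, (∑ η : Fin m → E, ∑ j, u (η j)) * Fintype.card E =
    m * (Fintype.card E : ℝ) ^ m * ∑ e, u e
  | 0 => by simp
  | m+1 => by
    have ih := blk1 u m
    rw [sum_fin_succ]
    simp only [Fin.sum_univ_succ, Fin.cons_zero, Fin.cons_succ, Finset.sum_add_distrib,
      Finset.sum_const, Finset.card_univ, nsmul_eq_mul, Fintype.card_pi, Finset.prod_const,
      Fintype.card_fin, ← Finset.mul_sum]
    push_cast
    linear_combination (Fintype.card E : ℝ) * ih

lemma blk2 (u w : E → ℝ) : ∀ m : ℕ,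
    (∑ η : Fin m → E, (∑ j, u (η j)) * (∑ j, w (η j))) * (Fintype.card E : ℝ) ^ 2 =
    m * (Fintype.card E : ℝ) ^ (m+1) * ∑ e, u e * w e +
      m * (m - 1) * (Fintype.card E : ℝ) ^ m * ((∑ e, u e) * (∑ e, w e))
  | 0 => by simp
  | m+1 => by
    have ih := blk2 u w m
    have hu := blk1 u m
    have hw := blk1 w m
    rw [sum_fin_succ]
    have : ∀ e : E, ∑ η : Fin m → E, (∑ j, u ((Fin.cons e η : Fin (m+1) → E) j)) *
        (∑ j, w ((Fin.cons e η : Fin (m+1) → E) j)) =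
        (Fintype.card E : ℝ) ^ m * (u e * w e) + u e * (∑ η : Fin m → E, ∑ j, w (η j)) +
        w e * (∑ η : Fin m → E, ∑ j, u (η j)) +
        ∑ η : Fin m → E, (∑ j, u (η j)) * (∑ j, w (η j)) := by
      intro e
      simp only [Fin.sum_univ_succ, Fin.cons_zero, Fin.cons_succ, Finset.mul_sum (a := u e),
        Finset.mul_sum (a := w e)]
      have : (Fintype.card E : ℝ) ^ m * (u e * w e) = ∑ η : Fin m → E, u e * w e := by
        simp
      rw [this, ← Finset.sum_add_distrib, ← Finset.sum_add_distrib, ← Finset.sum_add_distrib]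
      refine Finset.sum_congr rfl fun η _ => ?_
      rw [← Finset.mul_sum, ← Finset.mul_sum]
      ring
    simp only [this]
    simp only [Finset.sum_add_distrib, ← Finset.mul_sum, ← Finset.sum_mul, Finset.sum_const,
      Finset.card_univ, nsmul_eq_mul]
    push_cast
    linear_combination (Fintype.card E : ℝ) * ih + (Fintype.card E : ℝ) * (∑ e, u e) * hw +
      (Fintype.card E : ℝ) * (∑ e, w e) * hu

/-- number of occurrences -/
noncomputable def occ {m : ℕ} (η : Fin m → E) (g : E) : ℝ :=
  open Classical in ∑ j, if η j = g then 1 else 0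

lemma occ_nonneg {m : ℕ} (η : Fin m → E) (g : E) : 0 ≤ occ η g :=
  Finset.sum_nonneg fun i _ => by split_ifs <;> norm_num

lemma occ_ne {m : ℕ} (η : Fin m → E) (g : E) (h : occ η g ≠ 0) : ∃ j, η j = g := by
  classical
  by_contra hh
  push Not at hh
  exact h (Finset.sum_eq_zero fun j _ => if_neg (hh j))

lemma occ1 (m : ℕ) (g : E) (hE : 0 < Fintype.card E) :
    ∑ η : Fin m → E, occ η g = (Fintype.card E : ℝ) ^ m * (m / Fintype.card E) := by
  classical
  have h := blk1 (fun e => if e = g then (1:ℝ) else 0) m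
  have h0 : (0:ℝ) < Fintype.card E := by exact_mod_cast hE
  rw [← mul_div_assoc, eq_div_iff h0.ne']
  simp only [occ]
  rw [h]
  simp; ring

open Classical in
lemma occ2 (m : ℕ) (g g' : E) (hE : 0 < Fintype.card E) :
    ∑ η : Fin m → E, occ η g * occ η g' ≤ (Fintype.card E : ℝ) ^ m *
      ((if g = g' then (m / Fintype.card E : ℝ) else 0) + (m / Fintype.card E : ℝ) ^ 2) := by
  have h := blk2 (fun e => if e = g then (1:ℝ) else 0) (fun e => if e = g' then (1:ℝ) else 0) m
  have h0 : (0:ℝ) < Fintype.card E := by exact_mod_cast hE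
  have h1 : ∑ e : E, (if e = g then (1:ℝ) else 0) * (if e = g' then (1:ℝ) else 0) =
      if g = g' then 1 else 0 := by
    simp [eq_comm]
  rw [h1] at h
  simp only [Finset.sum_ite_eq', Finset.mem_univ, if_true, mul_one] at h
  rw [← mul_le_mul_iff_left₀ (pow_pos h0 2)]
  simp only [occ]
  rw [h]
  have hm : (m:ℝ) * (m - 1) ≤ m * m := by
    have : (0:ℝ) ≤ m := Nat.cast_nonneg m
    nlinarith
  have hpow : (0:ℝ) < (Fintype.card E : ℝ) ^ m := by positivity
  calc _ ≤ (m:ℝ) * (Fintype.card E : ℝ) ^ (m+1) * (if g = g' then 1 else 0) +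
        m * m * (Fintype.card E : ℝ) ^ m := by
        gcongr
    _ = _ := by
        split_ifs <;> (rw [pow_succ]; field_simp; try ring)

end Blocks

section Second
variable {γ : Type*} [Fintype γ] {H : SimpleGraph γ} {a b : γ} {n : ℕ}

open Classical in
noncomputable def Rt (a b : γ) (x y : Fin n) : Finset (γ → Fin n) :=
  Finset.univ.filter (fun φ => Function.Injective φ ∧ φ a = x ∧ φ b = y)

lemma Rt_card (hab : a ≠ b) (x y : Fin n) (hxy : x ≠ y) (hv : 2 ≤ Fintype.card γ)
    (hn : 2 * Fintype.card γ ≤ n) :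
    ((n:ℝ) / 2) ^ (Fintype.card γ - 2) ≤ (Rt a b x y).card := by
  classical
  let G := {z : γ // z ≠ a ∧ z ≠ b}
  let V := {z : Fin n // z ≠ x ∧ z ≠ y}
  have hG : Fintype.card G = Fintype.card γ - 2 := by
    rw [Fintype.card_subtype]
    have : Finset.univ.filter (fun z : γ => z ≠ a ∧ z ≠ b) = Finset.univ \ {a, b} := by
      ext; simp
    rw [this, Finset.card_sdiff_of_subset (Finset.subset_univ _), Finset.card_pair hab,
      Finset.card_univ]
  have hV : Fintype.card V = n - 2 := by
    rw [Fintype.card_subtype]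
    have : Finset.univ.filter (fun z : Fin n => z ≠ x ∧ z ≠ y) = Finset.univ \ {x, y} := by
      ext; simp
    rw [this, Finset.card_sdiff_of_subset (Finset.subset_univ _), Finset.card_pair hxy,
      Finset.card_univ, Fintype.card_fin]
  let T : (G ↪ V) → (γ → Fin n) := fun ψ z =>
    if h : z ≠ a ∧ z ≠ b then (ψ ⟨z, h⟩ : Fin n) else if z = a then x else y
  have hTa : ∀ ψ, T ψ a = x := fun ψ => by simp [T]
  have hTb : ∀ ψ, T ψ b = y := fun ψ => by simp [T, hab.symm]
  have hTz : ∀ ψ z (h : z ≠ a ∧ z ≠ b), T ψ z = ψ ⟨z, h⟩ := fun ψ z h => by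
    simp only [T]; rw [dif_pos h]
  have hmem : ∀ ψ, T ψ ∈ Rt a b x y := by
    intro ψ
    simp only [Rt, Finset.mem_filter, Finset.mem_univ, true_and]
    refine ⟨?_, hTa ψ, hTb ψ⟩
    intro z z' hzz
    by_cases h : z ≠ a ∧ z ≠ b <;> by_cases h' : z' ≠ a ∧ z' ≠ b
    · rw [hTz ψ z h, hTz ψ z' h'] at hzz
      have := ψ.injective (Subtype.ext hzz)
      exact congrArg Subtype.val this
    · have h2 := (ψ ⟨z, h⟩).2
      rw [hTz ψ z h] at hzz
      rw [not_and_or, not_not, not_not] at h'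
      rcases h' with rfl | rfl
      · rw [hTa] at hzz; exact absurd hzz h2.1
      · rw [hTb] at hzz; exact absurd hzz h2.2
    · have h2 := (ψ ⟨z', h'⟩).2
      rw [hTz ψ z' h'] at hzz
      rw [not_and_or, not_not, not_not] at h
      rcases h with rfl | rfl
      · rw [hTa] at hzz; exact absurd hzz.symm h2.1
      · rw [hTb] at hzz; exact absurd hzz.symm h2.2
    · rw [not_and_or, not_not, not_not] at h h'
      rcases h with rfl | rfl <;> rcases h' with rfl | rfl
      · rfl
      · rw [hTa, hTb] at hzz; exact absurd hzz hxy
      · rw [hTa, hTb] at hzz; exact absurd hzz.symm hxy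
      · rfl
  have hinj : Function.Injective T := by
    intro ψ ψ' h
    ext z
    have := congrFun h z.1
    rw [hTz ψ z.1 z.2, hTz ψ' z.1 z.2] at this
    exact congrArg _ this
  have h1 : Fintype.card (G ↪ V) ≤ (Rt a b x y).card := by
    rw [← Finset.card_univ]
    exact Finset.card_le_card_of_injOn T (fun ψ _ => hmem ψ) (fun ψ _ ψ' _ h => hinj h)
  rw [Fintype.card_embedding_eq, hG, hV] at h1
  have h2 := (Nat.pow_sub_le_descFactorial (n-2) (Fintype.card γ - 2)).trans h1
  calc ((n:ℝ) / 2) ^ (Fintype.card γ - 2)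
      ≤ ((n - 2 + 1 - (Fintype.card γ - 2) : ℕ) : ℝ) ^ (Fintype.card γ - 2) := by
        refine pow_le_pow_left₀ (by positivity) ?_ _
        rw [div_le_iff₀ (by norm_num)]
        have : n ≤ (n - 2 + 1 - (Fintype.card γ - 2)) * 2 := by omega
        exact_mod_cast this
    _ ≤ _ := by exact_mod_cast h2

open Classical in
lemma agree_card (hab : a ≠ b) (S : Finset (Sym2 γ)) (x y : Fin n) (φ : γ → Fin n) :
    ((Rt a b x y).filter (fun φ' => ∀ f ∈ S, Sym2.map φ f = Sym2.map φ' f)).card ≤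
      Fintype.card γ ^ (oS a b S).card * n ^ (Fintype.card γ - 2 - (oS a b S).card) := by
  have h1 := count_le (n := n) hab (oS a b S) (fun h => (mem_oS.1 h).1 rfl)
    (fun h => (mem_oS.1 h).2.1 rfl) (Finset.univ.image φ) x y
  refine (Finset.card_le_card ?_).trans (h1.trans ?_)
  · intro φ' hφ'
    simp only [Finset.mem_filter, Rt, Finset.mem_univ, true_and] at hφ' ⊢
    refine ⟨hφ'.1.2.1, hφ'.1.2.2, fun z hz => ?_⟩
    obtain ⟨_, _, f, hf, hzf⟩ := mem_oS.1 hz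
    have h2 : φ' z ∈ Sym2.map φ' f := Sym2.mem_map.2 ⟨z, hzf, rfl⟩
    rw [← hφ'.2 f hf] at h2
    obtain ⟨u, _, hu⟩ := Sym2.mem_map.1 h2
    exact Finset.mem_image.2 ⟨u, Finset.mem_univ _, hu⟩
  · refine Nat.mul_le_mul_right _ (Nat.pow_le_pow_left ?_ _)
    exact Finset.card_image_le

end Second

section SecondMoment
variable {J P E : Type*} [Fintype J] [Fintype P] [Fintype E]

open Classical in
lemma second_moment (G : P → J → E) (m : ℕ) (hm : 0 < m) (hE : 0 < Fintype.card E)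
    (p C : ℝ) (hp : p = m / Fintype.card E) (hC : 0 ≤ C)
    (h : ∀ φ, ∑ φ', ∏ f, ((if G φ f = G φ' f then p else 0) + p ^ 2) ≤
      p ^ (2 * Fintype.card J) * C) :
    (Fintype.card P : ℝ) * ((Fintype.card E : ℝ) ^ m) ^ Fintype.card J ≤
      ((Finset.univ.filter (fun ω : J → Fin m → E => ∃ φ, ∀ f, ∃ j, ω f j = G φ f)).card : ℝ)
        * C := by
  rcases Nat.eq_zero_or_pos (Fintype.card P) with hP | hP
  · rw [hP]; simp only [Nat.cast_zero, zero_mul]; positivity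
  have hE0 : (0:ℝ) < Fintype.card E := by exact_mod_cast hE
  have hP0 : (0:ℝ) < Fintype.card P := by exact_mod_cast hP
  have hp0 : 0 < p := by rw [hp]; have : (0:ℝ) < m := by exact_mod_cast hm
                         positivity
  set M : ℝ := (Fintype.card E : ℝ) ^ m with hM
  have hM0 : 0 < M := by positivity
  set X : (J → Fin m → E) → ℝ := fun ω => ∑ φ, ∏ f, occ (ω f) (G φ f) with hX
  have hsum : ∀ g : J → (Fin m → E) → ℝ, ∑ ω : J → Fin m → E, ∏ f, g f (ω f) =
      ∏ f, ∑ η, g f η := by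
    intro g
    rw [Finset.prod_univ_sum, Fintype.piFinset_univ]
  have h1 : ∑ ω, X ω = Fintype.card P * (M * p) ^ Fintype.card J := by
    rw [hX, Finset.sum_comm]
    have : ∀ φ : P, ∑ ω : J → Fin m → E, ∏ f, occ (ω f) (G φ f) = (M * p) ^ Fintype.card J := by
      intro φ
      rw [hsum (fun f η => occ η (G φ f))]
      simp only [occ1 m _ hE, ← hp, ← hM]
      simp
    simp only [this]
    simp
  have h2 : ∑ ω, X ω ^ 2 ≤ Fintype.card P * (M ^ Fintype.card J *
      (p ^ (2 * Fintype.card J) * C)) := by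
    have e1 : ∀ ω, X ω ^ 2 = ∑ φ, ∑ φ', ∏ f, (occ (ω f) (G φ f) * occ (ω f) (G φ' f)) := by
      intro ω
      rw [hX, sq, Finset.sum_mul_sum]
      simp only [Finset.prod_mul_distrib]
    simp only [e1]
    rw [Finset.sum_comm]
    rw [← nsmul_eq_mul, ← Finset.card_univ]
    refine Finset.sum_le_card_nsmul _ _ _ fun φ _ => ?_
    rw [Finset.sum_comm]
    refine le_trans ?_ (mul_le_mul_of_nonneg_left (h φ) (by positivity))
    rw [Finset.mul_sum]
    refine Finset.sum_le_sum fun φ' _ => ?_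
    rw [hsum (fun f η => occ η (G φ f) * occ η (G φ' f)), ← Finset.card_univ,
      ← Finset.prod_const, ← Finset.prod_mul_distrib]
    refine Finset.prod_le_prod (fun f _ => Finset.sum_nonneg fun η _ =>
      mul_nonneg (occ_nonneg _ _) (occ_nonneg _ _)) fun f _ => ?_
    have := occ2 m (G φ f) (G φ' f) hE
    rw [← hp] at this
    exact this
  set Z := Finset.univ.filter (fun ω : J → Fin m → E => ∃ φ, ∀ f, ∃ j, ω f j = G φ f) with hZ
  have h3 : (∑ ω, X ω) ^ 2 ≤ (Z.card : ℝ) * ∑ ω, X ω ^ 2 := by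
    have e2 : ∑ ω, X ω = ∑ ω ∈ Z, 1 * X ω := by
      rw [hZ, Finset.sum_filter]
      refine Finset.sum_congr rfl fun ω _ => ?_
      split_ifs with hh
      · ring
      · rw [hX]
        refine Finset.sum_eq_zero fun φ _ => ?_
        by_contra hne
        exact hh ⟨φ, fun f => occ_ne _ _ (Finset.prod_ne_zero_iff.1 hne f (Finset.mem_univ _))⟩
    rw [e2]
    refine (Finset.sum_mul_sq_le_sq_mul_sq _ _ _).trans ?_
    simp only [one_pow, Finset.sum_const, nsmul_eq_mul, mul_one]
    refine mul_le_mul_of_nonneg_left ?_ (Nat.cast_nonneg _)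
    exact Finset.sum_le_sum_of_subset_of_nonneg (Finset.subset_univ _) fun _ _ _ => sq_nonneg _
  rw [h1] at h3
  have h4 := h3.trans (mul_le_mul_of_nonneg_left h2 (Nat.cast_nonneg _))
  have hq : 0 < Fintype.card P * M ^ Fintype.card J * p ^ (2 * Fintype.card J) := by positivity
  refine le_of_mul_le_mul_left ?_ hq
  calc _ = (Fintype.card P * (M * p) ^ Fintype.card J) ^ 2 := by
        rw [mul_pow, pow_mul' p]; ring
    _ ≤ _ := h4
    _ = _ := by ring

end SecondMoment

section Chunks
variable {α : Type*} [DecidableEq α] (E0 : Finset α) (F : Finset α → ℝ)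

/-- sum over all sequences indexed by `ι` -/
noncomputable def QQ (ι : Type*) [Fintype ι] : ℝ :=
  open Classical in ∑ ω : ι → E0, F (Finset.univ.image (fun i => (ω i : α)))

lemma QQ_equiv {ι κ : Type*} [Fintype ι] [Fintype κ] (e : ι ≃ κ) : QQ E0 F ι = QQ E0 F κ := by
  classical
  simp only [QQ]
  refine Fintype.sum_equiv (Equiv.arrowCongr e (Equiv.refl _)) _ _ fun ω => ?_
  congr 1
  ext z
  simp only [Finset.mem_image, Finset.mem_univ, true_and, Equiv.arrowCongr_apply,
    Function.comp, Equiv.refl_apply]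
  constructor
  · rintro ⟨i, hi⟩; exact ⟨e i, by simpa using hi⟩
  · rintro ⟨i, hi⟩; exact ⟨e.symm i, hi⟩

lemma QQ_pow (hF : Antitone F) (h01 : ∀ T, F T = 0 ∨ F T = 1) (K : ℕ) {κ : Type*} [Fintype κ] :
    QQ E0 F (Fin K × κ) ≤ QQ E0 F κ ^ K := by
  classical
  have hF0 : ∀ T, 0 ≤ F T := fun T => by rcases h01 T with h | h <;> rw [h]; norm_num
  have hF1 : ∀ T, F T ≤ 1 := fun T => by rcases h01 T with h | h <;> rw [h]; norm_num
  have e1 : QQ E0 F κ ^ K = ∑ ω : Fin K → κ → E0,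
      ∏ j, F (Finset.univ.image (fun i => (ω j i : α))) := by
    have := Finset.prod_univ_sum (fun _ : Fin K => (Finset.univ : Finset (κ → E0)))
      (fun _ η => F (Finset.univ.image (fun i => (η i : α))))
    rw [Fintype.piFinset_univ] at this
    rw [← this]
    simp [QQ]
  rw [e1, QQ]
  have e2 : ∑ ω : Fin K × κ → E0, F (Finset.univ.image (fun i => (ω i : α))) =
      ∑ ω : Fin K → κ → E0, F (Finset.univ.image (fun i : Fin K × κ => (ω i.1 i.2 : α))) :=
    Fintype.sum_equiv (Equiv.curry (Fin K) κ E0) _ _ (fun ω => rfl)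
  refine le_trans (b := ∑ ω : Fin K → κ → E0,
    F (Finset.univ.image (fun i : Fin K × κ => (ω i.1 i.2 : α)))) (le_of_eq (by convert e2)) ?_
  refine Finset.sum_le_sum fun ω _ => ?_
  by_cases h : ∃ j, F (Finset.univ.image (fun i => (ω j i : α))) = 0
  · obtain ⟨j, hj⟩ := h
    refine le_trans ?_ (Finset.prod_nonneg fun j _ => hF0 _)
    rw [← hj]
    refine hF ?_
    intro z hz
    obtain ⟨i, _, rfl⟩ := Finset.mem_image.1 hz
    exact Finset.mem_image.2 ⟨(j, i), Finset.mem_univ _, rfl⟩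
  · push Not at h
    rw [Finset.prod_eq_one fun j _ => (h01 _).resolve_left (h j)]
    exact hF1 _

end Chunks

section Surv
variable {γ : Type*} [Fintype γ] {H : SimpleGraph γ} {a b : γ} {n : ℕ}

lemma oS_le (hab : a ≠ b) (S : Finset (Sym2 γ)) : (oS a b S).card ≤ Fintype.card γ - 2 := by
  classical
  have : oS a b S ⊆ Finset.univ \ {a, b} := by
    intro z hz
    obtain ⟨h1, h2, _⟩ := mem_oS.1 hz
    simp [h1, h2]
  refine (Finset.card_le_card this).trans ?_
  rw [Finset.card_sdiff_of_subset (Finset.subset_univ _), Finset.card_pair hab, Finset.card_univ]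

open Classical in
lemma corr (h : TwoBalanced H) (hab : H.Adj a b) (hn : 1 ≤ n) (p : ℝ)
    (hp : (n:ℝ) ^ (-(1 / d2 H)) ≤ p) (x y : Fin n) (φ : γ → Fin n) :
    ∑ φ' ∈ Rt a b x y, ∏ f ∈ JJ H a b,
      ((if Sym2.map φ f = Sym2.map φ' f then p else 0) + p ^ 2) ≤
    p ^ (2 * (JJ H a b).card) * (2 ^ (JJ H a b).card *
      ((Fintype.card γ : ℝ) ^ Fintype.card γ * (n:ℝ) ^ (Fintype.card γ - 2))) := by
  have hn0 : (1:ℝ) ≤ n := by exact_mod_cast hn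
  have hp0 : 0 < p := lt_of_lt_of_le (Real.rpow_pos_of_pos (by linarith) _) hp
  have hd := d2_pos h
  have hne := H.ne_of_adj hab
  simp only [Finset.prod_add]
  rw [Finset.sum_comm]
  have key : ∀ S ∈ (JJ H a b).powerset, ∑ φ' ∈ Rt a b x y,
      (∏ f ∈ S, (if Sym2.map φ f = Sym2.map φ' f then p else 0)) * (∏ f ∈ JJ H a b \ S, p ^ 2) ≤
      p ^ (2 * (JJ H a b).card) *
      ((Fintype.card γ : ℝ) ^ Fintype.card γ * (n:ℝ) ^ (Fintype.card γ - 2)) := by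
    intro S hS
    have hS' := Finset.mem_powerset.1 hS
    have hSc := Finset.card_le_card hS'
    set o := (oS a b S).card with ho
    have hov : o ≤ Fintype.card γ - 2 := oS_le hne S
    have e1 : ∀ φ' : γ → Fin n, (∏ f ∈ S, (if Sym2.map φ f = Sym2.map φ' f then p else 0)) =
        if (∀ f ∈ S, Sym2.map φ f = Sym2.map φ' f) then p ^ S.card else 0 := by
      intro φ'
      split_ifs with hh
      · rw [Finset.prod_congr rfl fun f hf => if_pos (hh f hf), Finset.prod_const]
      · push Not at hh
        obtain ⟨f, hf, hf'⟩ := hh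
        exact Finset.prod_eq_zero hf (if_neg hf')
    simp only [e1, Finset.prod_const, ← Finset.sum_mul]
    rw [← Finset.sum_filter, Finset.sum_const, nsmul_eq_mul, Finset.card_sdiff_of_subset hS']
    have hag : (((Rt a b x y).filter (fun φ' => ∀ f ∈ S, Sym2.map φ f = Sym2.map φ' f)).card : ℝ) ≤
      (Fintype.card γ : ℝ) ^ o * (n:ℝ) ^ (Fintype.card γ - 2 - o) := by
      exact_mod_cast agree_card hne S x y φ
    have hone : 1 ≤ p ^ S.card * (n:ℝ) ^ o := by
      have hb := bal h hab S hS'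
      have : (n:ℝ) ^ (-(1 / d2 H) * S.card + o) ≤ p ^ S.card * (n:ℝ) ^ o := by
        rw [Real.rpow_add (by linarith), Real.rpow_mul (by linarith), Real.rpow_natCast,
          Real.rpow_natCast]
        gcongr
      refine le_trans (Real.one_le_rpow hn0 ?_) this
      have : 1 / d2 H * S.card ≤ o := by
        rw [one_div, inv_mul_le_iff₀ hd]; exact hb
      linarith
    have hv1 : (1:ℝ) ≤ Fintype.card γ := by
      have := (card_ge_three h hab).1
      exact_mod_cast (by omega : 1 ≤ Fintype.card γ)
    calc _ ≤ (Fintype.card γ : ℝ) ^ o * (n:ℝ) ^ (Fintype.card γ - 2 - o) * p ^ S.card *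
          (p ^ 2) ^ ((JJ H a b).card - S.card) := by gcongr
      _ ≤ (Fintype.card γ : ℝ) ^ o * (n:ℝ) ^ (Fintype.card γ - 2 - o) * p ^ S.card *
          (p ^ 2) ^ ((JJ H a b).card - S.card) * (p ^ S.card * (n:ℝ) ^ o) :=
          le_mul_of_one_le_right (by positivity) hone
      _ = p ^ (2 * (JJ H a b).card) *
          ((Fintype.card γ : ℝ) ^ o * (n:ℝ) ^ (Fintype.card γ - 2)) := by
          have e2 : (2 * (JJ H a b).card) = S.card + S.card + 2 * ((JJ H a b).card - S.card) := by
            omega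
          have e3 : (n:ℝ) ^ (Fintype.card γ - 2) = (n:ℝ) ^ (Fintype.card γ - 2 - o) * (n:ℝ) ^ o := by
            rw [← pow_add]; congr 1; omega
          rw [e3, e2, pow_add, pow_add, pow_mul]; ring
      _ ≤ _ := by
          gcongr
          omega
  refine (Finset.sum_le_card_nsmul _ _ _ key).trans (le_of_eq ?_)
  rw [nsmul_eq_mul, Finset.card_powerset]
  push_cast
  ring

/-- success probability of a block -/
noncomputable def dl (H : SimpleGraph γ) (a b : γ) : ℝ :=
  1 / (2 ^ (Fintype.card γ - 2) * (2 ^ (JJ H a b).card * (Fintype.card γ : ℝ) ^ Fintype.card γ))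

lemma dl_pos (h : TwoBalanced H) (hab : H.Adj a b) : 0 < dl H a b := by
  have : 0 < Fintype.card γ := by have := (card_ge_three h hab).1; omega
  rw [dl]
  positivity

lemma dl_lt (h : TwoBalanced H) (hab : H.Adj a b) : dl H a b < 1 := by
  have h3 := (card_ge_three h hab).1
  have h3' : (1:ℝ) ≤ Fintype.card γ := by exact_mod_cast (by omega : 1 ≤ Fintype.card γ)
  rw [dl, div_lt_one (by positivity)]
  have h1 : (1:ℝ) < 2 ^ (Fintype.card γ - 2) := one_lt_pow₀ (by norm_num) (by omega)
  have h2 : (1:ℝ) ≤ 2 ^ (JJ H a b).card := one_le_pow₀ (by norm_num)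
  have h4 : (1:ℝ) ≤ (Fintype.card γ : ℝ) ^ Fintype.card γ := one_le_pow₀ h3'
  nlinarith [mul_le_mul h2 h4 (by norm_num) (by linarith)]

end Surv

section Surv2
variable {r : ℕ} {β : Fin r → Type*} [∀ i, Fintype (β i)] {n : ℕ}

open Classical in
noncomputable def Fz (Hs : ∀ i, SimpleGraph (β i)) (x y : Fin n) (T : Finset (Sym2 (Fin n))) : ℝ :=
  if ∃ t ∈ Cps Hs x y, Tt Hs t ⊆ T then 0 else 1

lemma Fz_anti (Hs : ∀ i, SimpleGraph (β i)) (x y : Fin n) : Antitone (Fz Hs x y) := by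
  intro A B hAB
  simp only [Fz]
  split_ifs with h1 h2 h2
  · exact le_rfl
  · norm_num
  · obtain ⟨t, ht, hT⟩ := h2
    exact absurd ⟨t, ht, hT.trans hAB⟩ h1
  · exact le_rfl

lemma Fz_01 (Hs : ∀ i, SimpleGraph (β i)) (x y : Fin n) (T) : Fz Hs x y T = 0 ∨ Fz Hs x y T = 1 := by
  simp only [Fz]; split_ifs <;> simp

lemma Fz_ins (Hs : ∀ i, SimpleGraph (β i)) (x y : Fin n) (T) :
    Fz Hs x y (insert s(x,y) T) = Fz Hs x y T := by
  simp only [Fz]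
  have : ∀ t ∈ Cps Hs x y, (Tt Hs t ⊆ insert s(x,y) T ↔ Tt Hs t ⊆ T) := by
    intro t ht
    refine Finset.subset_insert_iff_of_notMem fun h => ?_
    exact Finset.notMem_erase _ _ (Tt_sub Hs x y t ht h)
  congr 1
  simp only [eq_iff_iff]
  exact exists_congr fun t => and_congr_right (this t)

lemma chunk (Hs : ∀ i, SimpleGraph (β i)) (hHs : ∀ i, TwoBalanced (Hs i)) (i : Fin r)
    (a b : β i) (hab : (Hs i).Adj a b) (x y : Fin n) (hxy : x ≠ y)
    (hn : 2 * Fintype.card (β i) ≤ n) (m : ℕ) (hm : 0 < m)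
    (hp : (n:ℝ) ^ (-(1 / d2 (Hs i))) ≤ m / (allEdges n).card) :
    QQ (allEdges n) (Fz Hs x y) (JJ (Hs i) a b × Fin m) ≤
      (1 - dl (Hs i) a b) * ((allEdges n).card : ℝ) ^ ((JJ (Hs i) a b).card * m) := by
  classical
  have hne := (Hs i).ne_of_adj hab
  have h3 := (card_ge_three (hHs i) hab).1
  have hdl := dl_pos (hHs i) hab
  have hn1 : 1 ≤ n := by omega
  have hN : 0 < (allEdges n).card := by
    refine Finset.card_pos.2 ⟨s(x,y), ?_⟩
    simp [allEdges, hxy]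
  have hEc : Fintype.card (allEdges n) = (allEdges n).card := Fintype.card_coe _
  have hJc : Fintype.card (JJ (Hs i) a b) = (JJ (Hs i) a b).card := Fintype.card_coe _
  have hmemG : ∀ φ ∈ Rt a b x y, ∀ f ∈ JJ (Hs i) a b, Sym2.map φ f ∈ allEdges n := by
    intro φ hφ f hf
    have h1 : (⟨i, a, b, φ⟩ : Σ i, β i × β i × (β i → Fin n)) ∈ Cps Hs x y := by
      simp only [Cps, Finset.mem_filter, Finset.mem_univ, true_and]
      simp only [Rt, Finset.mem_filter, Finset.mem_univ, true_and] at hφ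
      exact ⟨hab, hφ⟩
    exact Finset.mem_of_mem_erase (Tt_sub Hs x y _ h1 (Finset.mem_image.2 ⟨f, hf, rfl⟩))
  let G : Rt (n := n) a b x y → JJ (Hs i) a b → allEdges n :=
    fun φ f => ⟨Sym2.map φ.1 f.1, hmemG φ.1 φ.2 f.1 f.2⟩
  have hsm := second_moment G m hm (by rw [hEc]; exact hN) (m / (allEdges n).card)
    (2 ^ (JJ (Hs i) a b).card *
      ((Fintype.card (β i) : ℝ) ^ Fintype.card (β i) * (n:ℝ) ^ (Fintype.card (β i) - 2)))
    (by rw [hEc]) (by positivity) (by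
      intro φ
      have := corr (hHs i) hab hn1 _ hp x y φ.1
      rw [hJc]
      refine le_trans (le_of_eq ?_) this
      rw [← Finset.sum_coe_sort (Rt a b x y)]
      refine Finset.sum_congr rfl fun φ' _ => ?_
      rw [← Finset.prod_coe_sort (JJ (Hs i) a b)]
      refine Finset.prod_congr rfl fun f _ => ?_
      simp only [G, Subtype.mk.injEq])
  rw [hEc, hJc, Fintype.card_coe] at hsm
  set Z := Finset.univ.filter
    (fun ω : JJ (Hs i) a b → Fin m → allEdges n => ∃ φ, ∀ f, ∃ j, ω f j = G φ f) with hZ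
  set M : ℝ := (((allEdges n).card : ℝ) ^ m) ^ (JJ (Hs i) a b).card with hM
  have hsm' : ((Rt a b x y).card : ℝ) * M ≤ Z.card * (2 ^ (JJ (Hs i) a b).card *
      ((Fintype.card (β i) : ℝ) ^ Fintype.card (β i) * (n:ℝ) ^ (Fintype.card (β i) - 2))) := by
    convert hsm
  have hM' : ((allEdges n).card : ℝ) ^ ((JJ (Hs i) a b).card * m) = M := by
    rw [hM, ← pow_mul, mul_comm]
  have hR := Rt_card hne x y hxy (by omega) hn
  have hn0 : (0:ℝ) < n := by exact_mod_cast hn1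
  have hZl : dl (Hs i) a b * M ≤ Z.card := by
    have hM0 : 0 ≤ M := by positivity
    have h5 := (mul_le_mul_of_nonneg_right hR hM0).trans hsm'
    have hv0 : (0:ℝ) < Fintype.card (β i) := by exact_mod_cast (by omega : 0 < Fintype.card (β i))
    rw [dl, div_mul_eq_mul_div, one_mul, div_le_iff₀ (by positivity)]
    have hnp : (0:ℝ) < (n:ℝ) ^ (Fintype.card (β i) - 2) := by positivity
    refine le_of_mul_le_mul_left ?_ hnp
    rw [div_pow, div_mul_eq_mul_div, div_le_iff₀ (by positivity)] at h5
    linarith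
  rw [hM', QQ]
  have e2 : ∑ ω : JJ (Hs i) a b × Fin m → allEdges n,
      Fz Hs x y (Finset.univ.image (fun i => (ω i : Sym2 (Fin n)))) =
      ∑ ω : JJ (Hs i) a b → Fin m → allEdges n,
      Fz Hs x y (Finset.univ.image (fun i : JJ (Hs i) a b × Fin m => (ω i.1 i.2 : Sym2 (Fin n)))) :=
    Fintype.sum_equiv (Equiv.curry _ _ _) _ _ (fun ω => rfl)
  have e3 : ∑ ω : JJ (Hs i) a b → Fin m → allEdges n,
      Fz Hs x y (Finset.univ.image (fun i : JJ (Hs i) a b × Fin m => (ω i.1 i.2 : Sym2 (Fin n))))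
      ≤ ∑ ω : JJ (Hs i) a b → Fin m → allEdges n, (1 - if ω ∈ Z then (1:ℝ) else 0) := by
    refine Finset.sum_le_sum fun ω _ => ?_
    split_ifs with hω
    · simp only [hZ, Finset.mem_filter, Finset.mem_univ, true_and] at hω
      obtain ⟨φ, hφ⟩ := hω
      rw [Fz, if_pos]
      · norm_num
      · refine ⟨⟨i, a, b, φ.1⟩, ?_, ?_⟩
        · simp only [Cps, Finset.mem_filter, Finset.mem_univ, true_and]
          have := φ.2
          simp only [Rt, Finset.mem_filter, Finset.mem_univ, true_and] at this
          exact ⟨hab, this⟩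
        · intro g hg
          obtain ⟨f, hf, rfl⟩ := Finset.mem_image.1 hg
          obtain ⟨j, hj⟩ := hφ ⟨f, hf⟩
          refine Finset.mem_image.2 ⟨(⟨f, hf⟩, j), Finset.mem_univ _, ?_⟩
          simp only [hj, G]
    · rcases Fz_01 Hs x y (Finset.univ.image
        (fun i : JJ (Hs i) a b × Fin m => (ω i.1 i.2 : Sym2 (Fin n)))) with h | h <;>
        rw [h] <;> norm_num
  have e4 : ∑ ω : JJ (Hs i) a b → Fin m → allEdges n, (1 - if ω ∈ Z then (1:ℝ) else 0) =
      M - Z.card := by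
    rw [Finset.sum_sub_distrib, Finset.sum_const, nsmul_eq_mul, Finset.card_univ]
    simp [hM]
  calc _ = _ := by convert e2
    _ ≤ _ := e3
    _ = _ := e4
    _ ≤ _ := by linarith

lemma surv (Hs : ∀ i, SimpleGraph (β i)) (hHs : ∀ i, TwoBalanced (Hs i)) (i : Fin r)
    (a b : β i) (hab : (Hs i).Adj a b)
    (hn : 2 * Fintype.card (β i) ≤ n) (m : ℕ) (hm : 0 < m)
    (hp : (n:ℝ) ^ (-(1 / d2 (Hs i))) ≤ m / (allEdges n).card) (K k : ℕ)
    (hk : K * ((JJ (Hs i) a b).card * m) ≤ k) (hkN : k + 1 ≤ (allEdges n).card) :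
    PE (k+1) (allEdges n) (sv Hs) ≤ (1 - dl (Hs i) a b) ^ K := by
  classical
  have hN : (0:ℝ) < (allEdges n).card := by
    have : 0 < (allEdges n).card := by omega
    exact_mod_cast this
  rw [PE, div_le_iff₀ hN, mul_comm, ← nsmul_eq_mul]
  refine Finset.sum_le_card_nsmul _ _ _ fun e he => ?_
  induction e using Sym2.ind with
  | _ x y =>
    have hxy : x ≠ y := by
      simpa [allEdges] using he
    have hc : ((allEdges n).erase s(x,y)).card = (allEdges n).card - 1 :=
      Finset.card_erase_of_mem he
    have hsv : ∀ l : List (Sym2 (Fin n)), sv Hs (s(x,y) :: l) = Fz Hs x y l.toFinset := by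
      intro l
      simp only [sv, Fz]
      rw [cp_iff Hs x y]
      congr
    simp only [hsv]
    set k' := K * ((JJ (Hs i) a b).card * m) with hk'
    obtain ⟨j, rfl⟩ := Nat.exists_eq_add_of_le hk
    calc PE (k' + j) ((allEdges n).erase s(x,y)) (fun l => Fz Hs x y l.toFinset)
        ≤ PE (k' + j) ((allEdges n).erase s(x,y)) (fun l => Fz Hs x y (l.drop j).toFinset) := by
          refine PE_mono _ _ _ _ fun l _ => Fz_anti Hs x y ?_
          intro z hz
          rw [List.mem_toFinset] at hz ⊢
          exact List.mem_of_mem_drop hz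
      _ = PE k' ((allEdges n).erase s(x,y)) (fun l => Fz Hs x y l.toFinset) :=
          PE_drop j k' _ (fun l => Fz Hs x y l.toFinset) (by omega)
      _ ≤ (∑ ω : Fin k' → allEdges n, Fz Hs x y (Finset.univ.image
            (fun i => (ω i : Sym2 (Fin n))))) / ((allEdges n).card : ℝ) ^ k' := by
          refine PE_dom (allEdges n) k' _ (Fz Hs x y) (Finset.erase_subset _ _) (by omega)
            (Fz_anti Hs x y) ?_
          intro T e he' hne
          have : e = s(x,y) := by
            by_contra h
            exact hne (Finset.mem_erase.2 ⟨h, he'⟩)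
          rw [this, Fz_ins]
      _ = QQ (allEdges n) (Fz Hs x y) (Fin k') / ((allEdges n).card : ℝ) ^ k' := by
          rw [QQ]; congr!
      _ = QQ (allEdges n) (Fz Hs x y) (Fin K × (JJ (Hs i) a b × Fin m)) /
            ((allEdges n).card : ℝ) ^ k' := by
          rw [QQ_equiv (allEdges n) (Fz Hs x y) (Fintype.equivOfCardEq (by simp [hk']) :
            Fin k' ≃ Fin K × (JJ (Hs i) a b × Fin m))]
      _ ≤ ((1 - dl (Hs i) a b) * ((allEdges n).card : ℝ) ^ ((JJ (Hs i) a b).card * m)) ^ K /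
            ((allEdges n).card : ℝ) ^ k' := by
          refine div_le_div_of_nonneg_right ?_ (by positivity)
          refine (QQ_pow _ _ (Fz_anti Hs x y) (Fz_01 Hs x y) K).trans ?_
          refine pow_le_pow_left₀ ?_ (chunk Hs hHs i a b hab x y hxy hn m hm hp) K
          refine Finset.sum_nonneg fun ω _ => ?_
          rcases Fz_01 Hs x y (Finset.univ.image
            (fun i => (ω i : Sym2 (Fin n)))) with h | h <;> rw [h]
          norm_num
      _ = _ := by
          rw [mul_pow, ← pow_mul, mul_comm ((JJ (Hs i) a b).card * m) K, ← hk',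
            mul_div_assoc, div_self (by positivity), mul_one]

end Surv2
section Lip
variable {r : ℕ} {β : Fin r → Type*} [∀ i, Fintype (β i)] {n : ℕ}

lemma reroot (Hs : ∀ i, SimpleGraph (β i)) (u v u' v' : Fin n) (t) (ht : t ∈ Cps Hs u v)
    (hg : s(u',v') ∈ Tt Hs t) :
    ∃ t' ∈ Cps Hs u' v', s(u,v) ∈ Tt Hs t' ∧ Tt Hs t' ⊆ insert s(u,v) (Tt Hs t) := by
  classical
  obtain ⟨i, a, b, φ⟩ := t
  simp only [Cps, Finset.mem_filter, Finset.mem_univ, true_and] at ht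
  obtain ⟨hab, hinj, hu, hv⟩ := ht
  obtain ⟨f, hf, hfe⟩ := Finset.mem_image.1 hg
  obtain ⟨hf1, hf2⟩ := mem_JJ.1 hf
  have hfe' : Sym2.map φ f = s(u',v') := hfe
  have key : ∀ c d, f = s(c,d) → φ c = u' → φ d = v' →
      ∃ t' ∈ Cps Hs u' v', s(u,v) ∈ Tt Hs t' ∧ Tt Hs t' ⊆ insert s(u,v) (Tt Hs ⟨i, a, b, φ⟩) := by
    intro c d hcd hc hd
    refine ⟨⟨i, c, d, φ⟩, ?_, ?_, ?_⟩
    · simp only [Cps, Finset.mem_filter, Finset.mem_univ, true_and]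
      rw [hcd] at hf2
      exact ⟨hf2, hinj, hc, hd⟩
    · refine Finset.mem_image.2 ⟨s(a,b), mem_JJ.2 ⟨?_, hab⟩, ?_⟩
      · rw [← hcd]; exact hf1.symm
      · change Sym2.map φ s(a,b) = _
        rw [Sym2.map_mk, hu, hv]
    · intro g hg
      obtain ⟨f', hf', rfl⟩ := Finset.mem_image.1 hg
      by_cases h : f' = s(a,b)
      · rw [Finset.mem_insert]; left
        change Sym2.map φ f' = _
        rw [h, Sym2.map_mk, hu, hv]
      · rw [Finset.mem_insert]; right
        exact Finset.mem_image.2 ⟨f', mem_JJ.2 ⟨h, (mem_JJ.1 hf').2⟩, rfl⟩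
  induction f using Sym2.ind with
  | _ c d =>
    rw [Sym2.map_mk, Sym2.eq_iff] at hfe'
    rcases hfe' with h | h
    · exact key c d rfl h.1 h.2
    · exact key d c Sym2.eq_swap h.2 h.1

open Classical in
noncomputable def Ae (Hs : ∀ i, SimpleGraph (β i)) (u v : Fin n) (Y : Finset (Sym2 (Fin n))) :
    Finset (Sym2 (Fin n)) :=
  Finset.univ.filter (fun e => ∃ t ∈ Cps Hs u v, e ∈ Tt Hs t ∧ Tt Hs t ⊆ Y)

lemma Ae_card (Hs : ∀ i, SimpleGraph (β i)) (eJ : ℕ)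
    (he : ∀ i, (Hs i).edgeSet.ncard ≤ eJ) (u v : Fin n) (Y : Finset (Sym2 (Fin n))) :
    ((Ae Hs u v Y).card : ℝ) ≤ eJ * Xc Hs u v Y := by
  classical
  have h1 : Ae Hs u v Y ⊆ ((Cps Hs u v).filter (fun t => Tt Hs t ⊆ Y)).biUnion (Tt Hs) := by
    intro e h
    simp only [Ae, Finset.mem_filter, Finset.mem_univ, true_and] at h
    obtain ⟨t, ht, h2, h3⟩ := h
    exact Finset.mem_biUnion.2 ⟨t, Finset.mem_filter.2 ⟨ht, h3⟩, h2⟩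
  have h2 : (Ae Hs u v Y).card ≤ ((Cps Hs u v).filter (fun t => Tt Hs t ⊆ Y)).card * eJ := by
    refine (Finset.card_le_card h1).trans (Finset.card_biUnion_le_card_mul _ _ _ fun t ht => ?_)
    have := Tt_card_le Hs eJ he u v t (Finset.mem_filter.1 ht).1
    omega
  have h3 : Xc Hs u v Y = ((Cps Hs u v).filter (fun t => Tt Hs t ⊆ Y)).card := by
    simp only [Xc]
    rw [Finset.card_filter]
    push_cast
    refine Finset.sum_congr rfl fun t _ => ?_
    congr
  rw [h3, mul_comm]
  exact_mod_cast h2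

open Classical in
/-- Hamming disagreement set -/
noncomputable def Dis {α : Type*} (m : ℕ) (x y : List α) : Finset ℕ :=
  (Finset.range m).filter (fun i => x[i]? ≠ y[i]?)

lemma mem_Dis {α : Type*} {m : ℕ} {x y : List α} {i : ℕ} :
    i ∈ Dis m x y ↔ i < m ∧ x[i]? ≠ y[i]? := by
  simp [Dis]

lemma Dis_tri {α : Type*} (m : ℕ) (x y z : List α) :
    ((Dis m x z).card : ℝ) ≤ (Dis m x y).card + (Dis m y z).card := by
  classical
  have : Dis m x z ⊆ Dis m x y ∪ Dis m y z := by
    intro i hi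
    rw [Finset.mem_union, mem_Dis, mem_Dis]
    rw [mem_Dis] at hi
    by_cases h : x[i]? = y[i]?
    · right; exact ⟨hi.1, h ▸ hi.2⟩
    · left; exact ⟨hi.1, h⟩
  exact_mod_cast (Finset.card_le_card this).trans (Finset.card_union_le _ _)

lemma Dis_self {α : Type*} (m : ℕ) (x : List α) : (Dis m x x).card = 0 := by
  rw [Finset.card_eq_zero, Finset.eq_empty_iff_forall_notMem]
  intro i hi
  exact (mem_Dis.1 hi).2 rfl

lemma Dis_le {α : Type*} (m : ℕ) (x y : List α) : (Dis m x y).card ≤ m := by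
  classical
  refine (Finset.card_filter_le _ _).trans ?_
  simp

lemma Dis_symm {α : Type*} (m : ℕ) (x y : List α) : Dis m x y = Dis m y x := by
  ext i; rw [mem_Dis, mem_Dis, ne_comm]

lemma Dis_swap {α : Type*} [DecidableEq α] (m : ℕ) (x : List α) (hx : x.Nodup) (a b : α) :
    (Dis m x (x.map (Equiv.swap a b))).card ≤ 2 := by
  classical
  have : (Dis m x (x.map (Equiv.swap a b))).image (fun i => x[i]?) ⊆ {some a, some b} := by
    intro z hz
    obtain ⟨i, hi, rfl⟩ := Finset.mem_image.1 hz
    rw [mem_Dis, List.getElem?_map] at hi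
    rcases h : x[i]? with _ | w
    · rw [h] at hi; simp at hi
    · rw [h] at hi
      simp only [Option.map_some, ne_eq, Option.some.injEq] at hi
      simp only [Finset.mem_insert, Finset.mem_singleton, Option.some.injEq]
      by_contra hh
      push Not at hh
      exact hi.2 (Equiv.swap_apply_of_ne_of_ne hh.1 hh.2).symm
  have h2 := Finset.card_le_card this
  rw [Finset.card_image_of_injOn] at h2
  · exact h2.trans (Finset.card_le_two)
  · intro i hi j hj hij
    have hi' := mem_Dis.1 hi
    have hil : i < x.length := by
      by_contra h
      rw [List.getElem?_map, List.getElem?_eq_none (by omega)] at hi'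
      simp at hi'
    exact (List.getElem?_inj hil hx).1 hij

open Classical in
lemma kM_lip (Hs : ∀ i, SimpleGraph (β i)) (eJ : ℕ)
    (he : ∀ i, (Hs i).edgeSet.ncard ≤ eJ) (m : ℕ) (x y : List (Sym2 (Fin n)))
    (hxl : x.length = m) (hyl : y.length = m) (hy : y.Nodup) (Del : ℝ)
    (hG : ∀ u v : Fin n, u ≠ v → Xc Hs u v y.toFinset ≤ Del) (hd : ∀ e ∈ y, e ∈ allEdges n) :
    (kM Hs x : ℝ) ≤ kM Hs y + (1 + eJ * Del) * (Dis m x y).card := by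
  have kx : ∀ z : List (Sym2 (Fin n)), z.length = m →
      (kM Hs z : ℝ) = ∑ i ∈ Finset.range m, sv Hs (z.drop i) := by
    intro z hz
    rw [kM_split Hs m z, List.drop_eq_nil_of_le (by omega)]
    simp [kM]
  have hrep : ∀ g : Sym2 (Fin n), ∃ u v, g = s(u,v) := by
    intro g
    induction g using Sym2.ind with
    | _ u v => exact ⟨u, v, rfl⟩
  choose U V hUV using hrep
  set D := Dis m x y with hD
  set Bad := (Finset.range m).filter
    (fun i => i ∉ D ∧ sv Hs (x.drop i) = 1 ∧ sv Hs (y.drop i) = 0) with hBad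
  have sv01 : ∀ z : List (Sym2 (Fin n)), sv Hs z = 0 ∨ sv Hs z = 1 := by
    intro z
    cases z with
    | nil => left; rfl
    | cons e l => simp only [sv]; split_ifs <;> simp
  have h1 : (kM Hs x : ℝ) ≤ kM Hs y + (D.card + Bad.card) := by
    rw [kx x hxl, kx y hyl]
    have e1 : (D.card : ℝ) = ∑ i ∈ Finset.range m, if i ∈ D then 1 else 0 := by
      rw [← Finset.sum_filter, Finset.sum_const, nsmul_eq_mul, mul_one]
      congr 2
      ext i
      simp only [Finset.mem_filter, Finset.mem_range]
      exact ⟨fun h => ⟨(mem_Dis.1 h).1, h⟩, fun h => h.2⟩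
    have e2 : (Bad.card : ℝ) = ∑ i ∈ Finset.range m, if i ∈ Bad then 1 else 0 := by
      rw [← Finset.sum_filter, Finset.sum_const, nsmul_eq_mul, mul_one]
      congr 2
      ext i
      simp only [Finset.mem_filter, Finset.mem_range]
      exact ⟨fun h => ⟨Finset.mem_range.1 (Finset.mem_filter.1 h).1, h⟩, fun h => h.2⟩
    rw [e1, e2, ← Finset.sum_add_distrib, ← Finset.sum_add_distrib]
    refine Finset.sum_le_sum fun i hi => ?_
    have hb : (i ∈ Bad) ↔ (i ∉ D ∧ sv Hs (x.drop i) = 1 ∧ sv Hs (y.drop i) = 0) := by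
      rw [hBad, Finset.mem_filter]; exact ⟨fun h => h.2, fun h => ⟨hi, h⟩⟩
    rcases sv01 (x.drop i) with h | h <;> rcases sv01 (y.drop i) with h' | h' <;>
      by_cases hiD : i ∈ D <;> simp [hb, h, h', hiD]
  have hmem : ∀ i ∈ Bad, ∃ j ∈ D, ∃ g ∈ y, y[j]? = some g ∧ ∃ e, y[i]? = some e ∧
      e ∈ Ae Hs (U g) (V g) y.toFinset := by
    intro i hi
    obtain ⟨him, hiD, hx1, hy0⟩ := Finset.mem_filter.1 hi
    rw [Finset.mem_range] at him
    have hxy : x[i]? = y[i]? := by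
      by_contra h
      exact hiD (mem_Dis.2 ⟨him, h⟩)
    have hix : i < x.length := by omega
    have hiy : i < y.length := by omega
    have hxy' : x[i] = y[i] := by
      rw [List.getElem?_eq_getElem hix, List.getElem?_eq_getElem hiy] at hxy
      exact Option.some.inj hxy
    rw [List.drop_eq_getElem_cons hix, hxy'] at hx1
    rw [List.drop_eq_getElem_cons hiy] at hy0
    obtain ⟨e, hee⟩ : ∃ e, y[i] = e := ⟨_, rfl⟩
    have hey : e ∈ y := hee ▸ List.getElem_mem hiy
    have hey? : y[i]? = some e := by rw [List.getElem?_eq_getElem hiy, hee]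
    rw [hee] at hx1 hy0
    obtain ⟨u, v, huv⟩ : ∃ u v, e = s(u,v) := ⟨_, _, hUV e⟩
    simp only [sv] at hx1 hy0
    rw [huv] at hx1 hy0
    rw [cp_iff] at hx1 hy0
    have hy1 : ∃ t ∈ Cps Hs u v, Tt Hs t ⊆ (y.drop (i+1)).toFinset := by
      by_contra h
      rw [if_neg h] at hy0
      norm_num at hy0
    have hx2 : ¬ ∃ t ∈ Cps Hs u v, Tt Hs t ⊆ (x.drop (i+1)).toFinset := by
      intro h
      rw [if_pos h] at hx1
      norm_num at hx1
    obtain ⟨t, ht, hT⟩ := hy1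
    have hTx : ¬ Tt Hs t ⊆ (x.drop (i+1)).toFinset := fun h => hx2 ⟨t, ht, h⟩
    obtain ⟨g, hg, hgx⟩ := Finset.not_subset.1 hTx
    have hgy := List.mem_toFinset.1 (hT hg)
    obtain ⟨k, hk, hkg⟩ := List.mem_iff_getElem.1 hgy
    rw [List.getElem_drop] at hkg
    rw [List.length_drop] at hk
    have hk? : y[i+1+k]? = some g := by rw [List.getElem?_eq_getElem (by omega), hkg]
    refine ⟨i+1+k, mem_Dis.2 ⟨by omega, ?_⟩, g, List.mem_of_mem_drop hgy, hk?, e, hey?, ?_⟩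
    · rw [hk?]
      intro h
      apply hgx
      rw [List.mem_toFinset, List.mem_iff_getElem?]
      exact ⟨k, by rw [List.getElem?_drop]; exact h⟩
    · rw [hUV g] at hg
      obtain ⟨t', ht', h1', h2'⟩ := reroot Hs u v (U g) (V g) t ht hg
      simp only [Ae, Finset.mem_filter, Finset.mem_univ, true_and]
      refine ⟨t', ht', huv ▸ h1', h2'.trans ?_⟩
      rw [← huv]
      refine Finset.insert_subset (List.mem_toFinset.2 hey) (hT.trans ?_)
      intro z hz
      exact List.mem_toFinset.2 (List.mem_of_mem_drop (List.mem_toFinset.1 hz))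
  have h2 : (Bad.card : ℝ) ≤ D.card * (eJ * Del) := by
    have s1 : Bad.card = (Bad.image (fun i => y[i]?)).card := by
      rw [Finset.card_image_of_injOn]
      intro i hi j hj hij
      have him := Finset.mem_range.1 (Finset.mem_filter.1 hi).1
      exact (List.getElem?_inj (by omega) hy).1 hij
    have s2 : Bad.image (fun i => y[i]?) ⊆ D.biUnion (fun j =>
        match y[j]? with
        | none => ∅
        | some g => if g ∈ y then (Ae Hs (U g) (V g) y.toFinset).image some else ∅) := by
      intro z hz
      obtain ⟨i, hi, rfl⟩ := Finset.mem_image.1 hz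
      obtain ⟨j, hj, g, hgy, hjg, e, hie, hA⟩ := hmem i hi
      refine Finset.mem_biUnion.2 ⟨j, hj, ?_⟩
      simp only [hjg, hie, if_pos hgy]
      exact Finset.mem_image_of_mem _ hA
    rw [s1]
    refine le_trans (Nat.cast_le.2 ((Finset.card_le_card s2).trans Finset.card_biUnion_le)) ?_
    push_cast
    rw [← nsmul_eq_mul]
    refine Finset.sum_le_card_nsmul _ _ _ fun j hj => ?_
    have hjm : j < m := (mem_Dis.1 hj).1
    have hj? : y[j]? = some (y[j]'(by omega)) := List.getElem?_eq_getElem (by omega)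
    obtain ⟨g, hg, hgy⟩ : ∃ g, y[j]? = some g ∧ g ∈ y := ⟨_, hj?, List.getElem_mem _⟩
    simp only [hg, if_pos hgy]
    have hne : U g ≠ V g := by
      have := hd g hgy
      rw [hUV g] at this
      simpa [allEdges] using this
    refine le_trans (Nat.cast_le.2 Finset.card_image_le) ((Ae_card Hs eJ he _ _ _).trans ?_)
    exact mul_le_mul_of_nonneg_left (hG _ _ hne) (Nat.cast_nonneg _)
  calc (kM Hs x : ℝ) ≤ _ := h1
    _ ≤ kM Hs y + (D.card + D.card * (eJ * Del)) := by linarith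
    _ = _ := by ring

end Lip

section McShane
variable {α : Type*} [DecidableEq α]

open Classical in
lemma conc (m : ℕ) (hm : 0 < m) (S : Finset α) (hmS : m ≤ S.card) (k : List α → ℝ)
    (Gd : List α → Prop) (c t : ℝ) (hc : 0 < c) (ht : 0 ≤ t)
    (hk0 : ∀ l, 0 ≤ k l) (hkm : ∀ l, Vld m S l → k l ≤ m)
    (hlip : ∀ x y, Vld m S x → Vld m S y → Gd y → k x ≤ k y + c * (Dis m x y).card) (q : ℝ)
    (hq : PE m S (fun l => if Gd l then 0 else 1) ≤ q) :
    PE m S (fun l => if t + (1 + c) * m * q < |k l - PE m S k| then 1 else 0) ≤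
      2 * Real.exp (-(t ^ 2 / (2 * m * (2 * c) ^ 2))) + q := by
  let Y := {y : List α // Vld m S y ∧ Gd y}
  let g : List α → ℝ := fun l => ⨅ y : Y, (k y.1 + c * (Dis m l y.1).card)
  have hbd : ∀ l, BddBelow (Set.range fun y : Y => (k y.1 + c * ((Dis m l y.1).card : ℝ))) := by
    intro l
    refine ⟨0, ?_⟩
    rintro _ ⟨y, rfl⟩
    have := hk0 y.1
    positivity
  have hg0 : ∀ l, 0 ≤ g l := by
    intro l
    refine Real.iInf_nonneg fun y => ?_
    have := hk0 y.1
    positivity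
  have hgm : ∀ l, g l ≤ (1 + c) * m := by
    intro l
    by_cases hY : Nonempty Y
    · obtain ⟨y⟩ := hY
      refine (ciInf_le (hbd l) y).trans ?_
      have h1 := hkm y.1 y.2.1
      have h2 : ((Dis m l y.1).card : ℝ) ≤ m := by exact_mod_cast Dis_le m l y.1
      have := mul_le_mul_of_nonneg_left h2 hc.le
      linarith
    · rw [not_nonempty_iff] at hY
      have : g l = 0 := Real.iInf_of_isEmpty _
      rw [this]; positivity
  have hgeq : ∀ l, Vld m S l → Gd l → g l = k l := by
    intro l hl hG
    have : Nonempty Y := ⟨⟨l, hl, hG⟩⟩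
    refine le_antisymm ?_ ?_
    · refine (ciInf_le (hbd l) ⟨l, hl, hG⟩).trans ?_
      rw [Dis_self]; simp
    · refine le_ciInf fun y => ?_
      exact hlip l y.1 hl y.2.1 y.2.2
  have hgl : ∀ x l, g x ≤ g l + c * (Dis m x l).card := by
    intro x l
    by_cases hY : Nonempty Y
    · rw [← sub_le_iff_le_add]
      refine le_ciInf fun y => ?_
      have h1 : g x ≤ k y.1 + c * (Dis m x y.1).card := ciInf_le (hbd x) y
      have h2 := mul_le_mul_of_nonneg_left (Dis_tri m x l y.1) hc.le
      linarith
    · rw [not_nonempty_iff] at hY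
      have h1 : g x = 0 := Real.iInf_of_isEmpty _
      have h2 : g l = 0 := Real.iInf_of_isEmpty _
      rw [h1, h2]; positivity
  have hsw : ∀ l, Vld m S l → ∀ a ∈ S, ∀ b ∈ S,
      |g (l.map (Equiv.swap a b)) - g l| ≤ 2 * c := by
    intro l hl a _ b _
    have h2 : ((Dis m l (l.map (Equiv.swap a b))).card : ℝ) ≤ 2 := by
      exact_mod_cast Dis_swap m l hl.1 a b
    have h3 := hgl l (l.map (Equiv.swap a b))
    have h4 := hgl (l.map (Equiv.swap a b)) l
    rw [Dis_symm] at h4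
    have := mul_le_mul_of_nonneg_left h2 hc.le
    rw [abs_le]
    constructor <;> linarith
  have htb := PE_tail_bound (2 * c) t (by linarith) ht m hm S g hmS hsw
  have hdiff : |PE m S g - PE m S k| ≤ (1 + c) * m * q := by
    have hpt : ∀ l, Vld m S l → |g l - k l| ≤ (1 + c) * m * (if Gd l then 0 else 1) := by
      intro l hl
      split_ifs with hG
      · rw [hgeq l hl hG]; simp
      · have h1 := hgm l
        have h2 := hkm l hl
        have h3 := hg0 l
        have h4 := hk0 l
        have h5 : 0 ≤ c * m := by positivity
        rw [abs_le]
        constructor <;> nlinarith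
    have hcm : 0 ≤ (1 + c) * m := by positivity
    have hb : PE m S (fun l => (1 + c) * m * (if Gd l then 0 else 1)) ≤ (1 + c) * m * q := by
      rw [PE_mul]
      exact mul_le_mul_of_nonneg_left hq hcm
    rw [← PE_sub, abs_le]
    constructor
    · have h1 := PE_mono m S (fun l => k l - g l) _ fun l hl =>
        (neg_abs_le (g l - k l) |> fun h => by linarith : k l - g l ≤ |g l - k l|).trans (hpt l hl)
      rw [PE_sub] at h1
      rw [PE_sub]
      linarith
    · exact (PE_mono m S (fun l => g l - k l) _ fun l hl =>
        (le_abs_self _).trans (hpt l hl)).trans hb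
  refine le_trans ?_ (add_le_add htb hq)
  rw [← PE_add]
  refine PE_mono _ _ _ _ fun l hl => ?_
  by_cases hG : Gd l
  · rw [if_pos hG, add_zero]
    split_ifs with h1 h2
    · exact le_rfl
    · exfalso
      rw [← hgeq l hl hG] at h1
      have h3 := abs_sub_le (g l) (PE m S g) (PE m S k)
      linarith
    · norm_num
    · exact le_rfl
  · rw [if_neg hG]
    split_ifs <;> norm_num

end McShane
section Asm
variable {r : ℕ} {β : Fin r → Type*} [∀ i, Fintype (β i)] {n : ℕ}

lemma geom_blocks (f : ℕ → ℝ) (N b : ℕ) (ρ : ℝ) (hb : 0 < b) (hρ0 : 0 ≤ ρ) (hρ1 : ρ < 1)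
    (h : ∀ i < N, ∀ K, K * b ≤ i → f i ≤ ρ ^ K) :
    ∑ i ∈ Finset.range N, f i ≤ b / (1 - ρ) := by
  have h1 : ∑ i ∈ Finset.range N, f i ≤ ∑ i ∈ Finset.range N, ρ ^ (i / b) :=
    Finset.sum_le_sum fun i hi => h i (Finset.mem_range.1 hi) _ (Nat.div_mul_le_self i b)
  have h2 : ∑ i ∈ Finset.range N, ρ ^ (i / b) ≤ ∑ i ∈ Finset.range (N * b), ρ ^ (i / b) := by
    refine Finset.sum_le_sum_of_subset_of_nonneg ?_ fun _ _ _ => by positivity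
    intro i hi
    rw [Finset.mem_range] at *
    nlinarith
  have h3 : ∀ M : ℕ, ∑ i ∈ Finset.range (M * b), ρ ^ (i / b) =
      b * ∑ K ∈ Finset.range M, ρ ^ K := by
    intro M
    induction M with
    | zero => simp
    | succ M ih =>
      rw [Nat.succ_mul, Finset.sum_range_add, ih, Finset.sum_range_succ, mul_add]
      congr 1
      rw [Finset.sum_congr rfl (g := fun _ => ρ ^ M)]
      · simp
      · intro i hi
        rw [Finset.mem_range] at hi
        congr 1
        rw [mul_comm M b, Nat.mul_add_div hb, Nat.div_eq_of_lt hi, add_zero]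
  have h4 : ∑ K ∈ Finset.range N, ρ ^ K ≤ (1 - ρ)⁻¹ := by
    rw [← tsum_geometric_of_lt_one hρ0 hρ1]
    exact Summable.sum_le_tsum _ (fun _ _ => by positivity)
      (summable_geometric_of_lt_one hρ0 hρ1)
  refine h1.trans (h2.trans ?_)
  rw [h3, div_eq_mul_inv]
  exact mul_le_mul_of_nonneg_left h4 (Nat.cast_nonneg _)

open Classical in
lemma main_conc (Hs : ∀ i, SimpleGraph (β i)) (eJ : ℕ)
    (he : ∀ i, (Hs i).edgeSet.ncard ≤ eJ) (m j : ℕ) (hm : 0 < m)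
    (hmj : m + j = (allEdges n).card) (Del t q1 q2 : ℝ) (hDel : 0 ≤ Del) (ht : 0 ≤ t)
    (hq1 : PE m (allEdges n) (fun l => if (∀ u v : Fin n, u ≠ v → Xc Hs u v l.toFinset ≤ Del)
      then 0 else 1) ≤ q1)
    (hq2 : ∀ k, m ≤ k → k + 1 ≤ (allEdges n).card → j * PE (k+1) (allEdges n) (sv Hs) ≤ q2)
    (hq20 : 0 ≤ q2) (T : ℝ) (hT : t + (1 + (1 + eJ * Del)) * m * q1 + q2 ≤ T) :
    PE (allEdges n).card (allEdges n) (fun l =>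
      if |(kM Hs l : ℝ) - PE (allEdges n).card (allEdges n) (fun l => (kM Hs l : ℝ))| ≤ T
      then 0 else 1) ≤
      2 * Real.exp (-(t ^ 2 / (2 * m * (2 * (1 + eJ * Del)) ^ 2))) + q1 + q2 := by
  set S := allEdges n with hS
  set c : ℝ := 1 + eJ * Del with hc
  have hc0 : 0 < c := by positivity
  have hcc := conc m hm S (by omega) (fun l => (kM Hs l : ℝ))
    (fun l => ∀ u v : Fin n, u ≠ v → Xc Hs u v l.toFinset ≤ Del) c t hc0 ht
    (fun l => Nat.cast_nonneg _)
    (fun l hl => by rw [← hl.2.1]; exact_mod_cast kM_le_length Hs l)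
    (fun x y hx hy hG => kM_lip Hs eJ he m x y hx.2.1 hy.2.1 hy.1 Del hG hy.2.2) q1 (by convert hq1)
  rw [← PE_drop j m S _ (by omega)] at hcc
  have hsvs : ∑ i ∈ Finset.range j, PE S.card S (fun l => sv Hs (l.drop i)) ≤ q2 := by
    rcases Nat.eq_zero_or_pos j with h0 | h0
    · rw [h0]; simpa using hq20
    have : ∀ i ∈ Finset.range j, PE S.card S (fun l => sv Hs (l.drop i)) ≤ q2 / j := by
      intro i hi
      rw [Finset.mem_range] at hi
      have h1 := hq2 (S.card - i - 1) (by omega) (by omega)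
      have h2 := PE_drop i (S.card - i - 1 + 1) S (sv Hs) (by omega)
      rw [show S.card - i - 1 + 1 + i = S.card by omega] at h2
      rw [h2, le_div_iff₀ (by exact_mod_cast h0), mul_comm]
      exact h1
    refine (Finset.sum_le_card_nsmul _ _ _ this).trans ?_
    rw [Finset.card_range, nsmul_eq_mul, mul_div_cancel₀]
    exact_mod_cast h0.ne'
  rw [hmj] at hcc
  rw [← PE_sum] at hsvs
  have hEM : PE S.card S (fun l => (kM Hs l : ℝ)) = PE m S (fun l => (kM Hs l : ℝ)) +
      PE S.card S (fun l => ∑ i ∈ Finset.range j, sv Hs (l.drop i)) := by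
    rw [← PE_drop j m S (fun l => (kM Hs l : ℝ)) (by omega), hmj, ← PE_add]
    exact PE_congr _ _ _ _ fun l _ => kM_split Hs j l
  have hR0 : 0 ≤ PE S.card S (fun l => ∑ i ∈ Finset.range j, sv Hs (l.drop i)) :=
    PE_nonneg _ _ _ fun l _ => Finset.sum_nonneg fun i _ => sv_nonneg _ _
  refine le_trans ?_ (add_le_add hcc hsvs)
  rw [← PE_add]
  refine PE_mono _ _ _ _ fun l _ => ?_
  have hRl : 0 ≤ ∑ i ∈ Finset.range j, sv Hs (l.drop i) :=
    Finset.sum_nonneg fun i _ => sv_nonneg _ _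
  have h01 : (∑ i ∈ Finset.range j, sv Hs (l.drop i)) = 0 ∨
      1 ≤ ∑ i ∈ Finset.range j, sv Hs (l.drop i) := by
    by_cases h : ∃ i ∈ Finset.range j, sv Hs (l.drop i) ≠ 0
    · right
      obtain ⟨i, hi, hne⟩ := h
      have h1 : sv Hs (l.drop i) = 1 := by
        rcases hz : l.drop i with _ | ⟨e, l'⟩
        · rw [hz] at hne; exact absurd rfl hne
        · rw [hz] at hne
          simp only [sv] at hne ⊢
          split_ifs with hh
          · rw [if_pos hh] at hne; exact absurd rfl hne
          · rfl
      rw [← h1]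
      exact Finset.single_le_sum (f := fun i => sv Hs (l.drop i))
        (fun i _ => sv_nonneg _ _) hi
    · left
      push Not at h
      exact Finset.sum_eq_zero h
  rcases h01 with h0 | h1
  · rw [h0, add_zero]
    by_cases hB : t + (1 + c) * m * q1 < |(kM Hs (l.drop j) : ℝ) - PE m S (fun l => (kM Hs l : ℝ))|
    · rw [if_pos hB]
      split_ifs <;> norm_num
    · rw [if_neg hB, if_pos]
      rw [kM_split Hs j l, h0, add_zero, hEM]
      rw [not_lt] at hB
      have h3 := abs_sub ((kM Hs (l.drop j) : ℝ) - PE m S (fun l => (kM Hs l : ℝ)))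
        (PE S.card S (fun l => ∑ i ∈ Finset.range j, sv Hs (l.drop i)))
      rw [abs_of_nonneg hR0] at h3
      rw [← sub_sub]
      linarith
  · refine le_trans ?_ (add_le_add_right h1 _)
    split_ifs <;> norm_num

end Asm
section Num
variable {r : ℕ} {β : Fin r → Type*} [∀ i, Fintype (β i)] {n : ℕ}

lemma N_bounds (hn : 4 ≤ n) : (n:ℝ)^2/4 ≤ ((allEdges n).card : ℝ) ∧
    ((allEdges n).card : ℝ) ≤ (n:ℝ)^2/2 ∧ (n:ℝ)^2/8 ≤ ((allEdges n).card : ℝ) - 1 := by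
  have h : (4:ℝ) ≤ n := by exact_mod_cast hn
  rw [card_allEdges, Nat.cast_choose_two]
  refine ⟨?_, ?_, ?_⟩ <;> nlinarith

lemma X_eq (hn : 4 ≤ n) (d : ℝ) :
    (n:ℝ) ^ (2 - 1/d) = (n:ℝ)^2 * (n:ℝ) ^ (-(1/d)) := by
  have h : (0:ℝ) < n := by exact_mod_cast (by omega : 0 < n)
  rw [sub_eq_add_neg, Real.rpow_add h]
  norm_num

lemma X_ge_one (hn : 4 ≤ n) (d : ℝ) (hd : 1/2 ≤ d) : 1 ≤ (n:ℝ) ^ (2 - 1/d) := by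
  have h : (1:ℝ) ≤ n := by exact_mod_cast (by omega : 1 ≤ n)
  apply Real.one_le_rpow h
  rw [sub_nonneg, div_le_iff₀ (by linarith)]
  linarith

lemma P_le_one (hn : 4 ≤ n) (d : ℝ) (hd : 1/2 ≤ d) : (n:ℝ) ^ (-(1/d)) ≤ 1 := by
  have h : (1:ℝ) ≤ n := by exact_mod_cast (by omega : 1 ≤ n)
  apply Real.rpow_le_one_of_one_le_of_nonpos h
  have : 0 < 1/d := by apply div_pos <;> linarith
  linarith

lemma m0_bounds (hn : 4 ≤ n) (d : ℝ) (hd : 1/2 ≤ d) :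
    0 < ⌈(n:ℝ) ^ (2 - 1/d)⌉₊ ∧ (⌈(n:ℝ) ^ (2 - 1/d)⌉₊ : ℝ) ≤ 2 * (n:ℝ) ^ (2 - 1/d) ∧
    (n:ℝ) ^ (-(1/d)) ≤ (⌈(n:ℝ) ^ (2 - 1/d)⌉₊ : ℝ) / (allEdges n).card := by
  have h1 := X_ge_one hn d hd
  have h2 := Nat.ceil_lt_add_one (by linarith : 0 ≤ (n:ℝ) ^ (2 - 1/d))
  have h3 := Nat.le_ceil ((n:ℝ) ^ (2 - 1/d))
  obtain ⟨h4, h5, h6⟩ := N_bounds hn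
  have h7 : (4:ℝ) ≤ n := by exact_mod_cast hn
  refine ⟨Nat.ceil_pos.2 (by linarith), by linarith, ?_⟩
  rw [le_div_iff₀ (by nlinarith)]
  refine le_trans ?_ h3
  rw [X_eq hn d, mul_comm]
  have h8 : 0 ≤ (n:ℝ) ^ (-(1/d)) := by positivity
  refine mul_le_mul_of_nonneg_right ?_ h8
  nlinarith

lemma EM_upper (Hs : ∀ i, SimpleGraph (β i)) (hHs : ∀ i, TwoBalanced (Hs i)) (i : Fin r)
    (a b : β i) (hab : (Hs i).Adj a b) (hn : 2 * Fintype.card (β i) ≤ n) (hn4 : 4 ≤ n) :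
    PE (allEdges n).card (allEdges n) (fun l => (kM Hs l : ℝ)) ≤
      (2 * (JJ (Hs i) a b).card / dl (Hs i) a b) * (n:ℝ) ^ (2 - 1/d2 (Hs i)) := by
  obtain ⟨h1, h2, h3⟩ := m0_bounds hn4 (d2 (Hs i)) (two_le (hHs i))
  have hδ := dl_pos (hHs i) hab
  have hδ1 := dl_lt (hHs i) hab
  have hJ := (card_ge_three (hHs i) hab).2.card_pos
  rw [EM_eq _ _ _ le_rfl]
  refine (geom_blocks _ _ ((JJ (Hs i) a b).card * ⌈(n:ℝ) ^ (2 - 1/d2 (Hs i))⌉₊)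
    (1 - dl (Hs i) a b) (Nat.mul_pos hJ h1) (by linarith) (by linarith) ?_).trans ?_
  · intro k hk K hK
    exact surv Hs hHs i a b hab hn _ h1 h3 K k hK hk
  · rw [sub_sub_cancel]
    push_cast
    rw [div_mul_eq_mul_div]
    refine div_le_div_of_nonneg_right ?_ hδ.le
    have : (0:ℝ) ≤ (JJ (Hs i) a b).card := by positivity
    nlinarith

lemma EM_lower (Hs : ∀ i, SimpleGraph (β i)) (hHs : ∀ i, TwoBalanced (Hs i)) (i : Fin r)
    (hi : ∀ j, d2 (Hs i) ≤ d2 (Hs j)) (hn4 : 4 ≤ n) :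
    (1/(32*(D0 β + 1))) * (n:ℝ) ^ (2 - 1/d2 (Hs i)) ≤
    PE (allEdges n).card (allEdges n) (fun l => (kM Hs l : ℝ)) := by
  have hD := D0_nonneg (β := β)
  set d := d2 (Hs i) with hd
  have hd2 : 1/2 ≤ d := two_le (hHs i)
  set X := (n:ℝ) ^ (2 - 1/d) with hX
  have hX1 : 1 ≤ X := X_ge_one hn4 d hd2
  set lam : ℝ := 1/(2*(D0 β + 1)) with hlam
  have hl0 : 0 < lam := by positivity
  have hl1 : lam ≤ 1/2 := by
    rw [hlam, div_le_div_iff₀ (by positivity) (by norm_num)]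
    linarith
  have hlD : D0 β * lam ≤ 1/2 := by
    rw [hlam, mul_one_div, div_le_div_iff₀ (by positivity) (by norm_num)]
    linarith
  have hP0 : 0 ≤ (n:ℝ) ^ (-(1/d)) := by positivity
  have hP1 := P_le_one hn4 d hd2
  obtain ⟨h4, h5, h6⟩ := N_bounds hn4
  have h7 : (4:ℝ) ≤ n := by exact_mod_cast hn4
  have hXe : X = (n:ℝ)^2 * (n:ℝ) ^ (-(1/d)) := X_eq hn4 d
  set m1 := ⌈lam/8*X⌉₊ with hm1
  have hm1N : m1 ≤ (allEdges n).card := by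
    have := Nat.ceil_lt_add_one (by positivity : 0 ≤ lam/8*X)
    have h8 : X ≤ (n:ℝ)^2 := by rw [hXe]; nlinarith [sq_nonneg (n:ℝ)]
    have : (m1:ℝ) ≤ (allEdges n).card := by
      have : lam/8*X ≤ (1/2)/8*(n:ℝ)^2 := by gcongr
      nlinarith
    exact_mod_cast this
  rw [EM_eq _ _ _ le_rfl]
  have key : ∀ k ∈ Finset.range m1, (1/2:ℝ) ≤ PE (k+1) (allEdges n) (sv Hs) := by
    intro k hk
    rw [Finset.mem_range] at hk
    have hk' := Nat.lt_ceil.1 hk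
    have := sv_lower (n := n) Hs k (by omega) (1/2) (fun x y =>
      (F2_small Hs hHs (by omega) d (by linarith) hi _ lam
        (div_nonneg (by positivity) (by nlinarith)) hl0.le (by linarith) (by
          rw [div_le_iff₀ (by nlinarith)]
          refine hk'.le.trans ?_
          rw [hXe]
          have : lam/8*((n:ℝ)^2 * (n:ℝ) ^ (-(1/d))) = lam*(n:ℝ) ^ (-(1/d)) * ((n:ℝ)^2/8) := by ring
          rw [this]
          exact mul_le_mul_of_nonneg_left h6 (by positivity)) x y).trans hlD)
    linarith
  calc _ = lam/8*X * (1/2) := by rw [hlam]; field_simp; norm_num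
    _ ≤ m1 * (1/2) := by gcongr; exact Nat.le_ceil _
    _ = ∑ k ∈ Finset.range m1, (1/2:ℝ) := by simp
    _ ≤ ∑ k ∈ Finset.range m1, PE (k+1) (allEdges n) (sv Hs) := Finset.sum_le_sum key
    _ ≤ _ := Finset.sum_le_sum_of_subset_of_nonneg (Finset.range_mono hm1N)
      fun _ _ _ => PE_nonneg _ _ _ fun l _ => sv_nonneg Hs l

open Classical in
lemma q1_bound (Hs : ∀ i, SimpleGraph (β i)) (m : ℕ) (Del q : ℝ)
    (h : ∀ x y : Fin n, PE m (allEdges n)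
      (fun l => if Del < Xc Hs x y l.toFinset then (1:ℝ) else 0) ≤ q) :
    PE m (allEdges n) (fun l => if (∀ u v : Fin n, u ≠ v → Xc Hs u v l.toFinset ≤ Del)
      then (0:ℝ) else 1) ≤ (n:ℝ)^2 * q := by
  calc _ ≤ PE m (allEdges n) (fun l => ∑ x : Fin n × Fin n,
        if Del < Xc Hs x.1 x.2 l.toFinset then (1:ℝ) else 0) := by
        refine PE_mono _ _ _ _ fun l _ => ?_
        have hnn : ∀ x : Fin n × Fin n, x ∈ Finset.univ → (0:ℝ) ≤
          if Del < Xc Hs x.1 x.2 l.toFinset then (1:ℝ) else 0 := by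
          intro x _; split_ifs <;> norm_num
        split_ifs with h1
        · exact Finset.sum_nonneg hnn
        · push Not at h1
          obtain ⟨u, v, _, h2⟩ := h1
          refine le_trans ?_ (Finset.single_le_sum hnn (Finset.mem_univ (u, v)))
          rw [if_pos h2]
    _ ≤ ∑ x : Fin n × Fin n, q := by
        rw [PE_sum]
        exact Finset.sum_le_sum fun x _ => h x.1 x.2
    _ = _ := by simp [sq]

set_option maxHeartbeats 4000000 in
open Classical in
lemma conc_n (Hs : ∀ i, SimpleGraph (β i)) (hHs : ∀ i, TwoBalanced (Hs i)) (i : Fin r)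
    (hi : ∀ j, d2 (Hs i) ≤ d2 (Hs j)) (a b : β i) (hab : (Hs i).Adj a b) (e : ℕ)
    (he2 : 2 ≤ e) (he : ∀ i, (Hs i).edgeSet.ncard ≤ e) (c : ℝ) (hc : 0 < c)
    (hn : 2 * Fintype.card (β i) ≤ n) (hn4 : 4 ≤ n) (L : ℝ) (hL : L = Real.log n)
    (hL1 : 1 ≤ L) (hLδ : c + 10 ≤ dl (Hs i) a b * L)
    (hLc : 32 * (JJ (Hs i) a b).card * (1 + (e:ℝ))^2 * (c + 8) ≤ L)
    (hLD : D0 β * (2^e * (8*(e:ℝ))^(2*(e-1))) * Real.exp (c+10) ≤ L)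
    (hLa : 3 ≤ √(1/(32*(D0 β + 1))) * L)
    (hLm : 16 * (JJ (Hs i) a b).card * L^2 * (n:ℝ) ^ (-(1/d2 (Hs i))) ≤ 1)
    (hLn : (2 + (e:ℝ)) * L^(2*e-1) ≤ n) :
    PE (allEdges n).card (allEdges n) (fun l =>
      if |(kM Hs l : ℝ) - PE (allEdges n).card (allEdges n) (fun l => (kM Hs l : ℝ))| ≤
        √(PE (allEdges n).card (allEdges n) (fun l => (kM Hs l : ℝ))) * L^(4*e)
      then (0:ℝ) else 1) ≤ (n:ℝ) ^ (-c) := by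
  have hlow := EM_lower Hs hHs i hi hn4
  obtain ⟨hm0, hm02, hm0P⟩ := m0_bounds hn4 (d2 (Hs i)) (two_le (hHs i))
  have hX1 := X_ge_one hn4 (d2 (Hs i)) (two_le (hHs i))
  have hXe := X_eq hn4 (d2 (Hs i))
  have hP0 : 0 ≤ (n:ℝ) ^ (-(1/d2 (Hs i))) := by positivity
  have hδ := dl_pos (hHs i) hab
  have hδ1 := dl_lt (hHs i) hab
  have hJ := (card_ge_three (hHs i) hab).2.card_pos
  have hJe : (JJ (Hs i) a b).card + 1 ≤ e := by rw [JJ_card hab]; exact he i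
  have hd := two_le (hHs i)
  obtain ⟨hN4, hN2, hN8⟩ := N_bounds hn4
  have hNpos : (0:ℝ) < (allEdges n).card := by nlinarith [(by exact_mod_cast hn4 : (4:ℝ) ≤ n)]
  have hD := D0_nonneg (β := β)
  have hn' : (4:ℝ) ≤ n := by exact_mod_cast hn4
  have hexp : (n:ℝ) = Real.exp L := by rw [hL, Real.exp_log (by linarith)]
  have hsurv := fun m0 hm0 hm0P K => surv Hs hHs i a b hab hn m0 hm0 hm0P K
  have hF2 := fun p w hp hw hpl => F2_big Hs hHs (n := n) (by omega) (d2 (Hs i)) (by linarith)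
    hi e he p w hp hw hpl
  have hmain := main_conc (n := n) Hs e he
  set J := (JJ (Hs i) a b).card with hJdef
  set δ := dl (Hs i) a b with hδdef
  set X := (n:ℝ) ^ (2 - 1/d2 (Hs i)) with hX
  set P := (n:ℝ) ^ (-(1/d2 (Hs i))) with hP
  set m0 := ⌈X⌉₊ with hm0def
  set EM := PE (allEdges n).card (allEdges n) (fun l => (kM Hs l : ℝ)) with hEM
  clear_value J δ m0 X P EM
  have hJ' : (1:ℝ) ≤ J := by exact_mod_cast hJ
  have hJe' : (J:ℝ) + 1 ≤ e := by exact_mod_cast hJe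
  have he2' : (2:ℝ) ≤ e := by exact_mod_cast he2
  have hL0 : 0 < L := by linarith
  set y := Real.exp (-((c+8)*L)) with hy
  have hy0 : 0 < y := Real.exp_pos _
  have hy2 : (n:ℝ)^2 * Real.exp (-((c+10)*L)) = y := by
    rw [hexp, ← Real.exp_nat_mul, ← Real.exp_add, hy]
    congr 1; push_cast; ring
  -- parameters
  set K := ⌈L^2⌉₊ with hK
  have hK1 : L^2 ≤ K := Nat.le_ceil _
  have hK2 : (K:ℝ) ≤ 2*L^2 := by
    have := Nat.ceil_lt_add_one (by positivity : 0 ≤ L^2)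
    have h3 : 1 ≤ L^2 := one_le_pow₀ hL1
    linarith
  have hK0 : 0 < K := Nat.ceil_pos.2 (by positivity)
  clear_value K
  set m := K * (J * m0) with hm
  have hmpos : 0 < m := Nat.mul_pos hK0 (Nat.mul_pos hJ hm0)
  have hmR : (m:ℝ) = K * (J * m0) := by rw [hm]; push_cast; ring
  clear_value m
  have hmX : (m:ℝ) ≤ 4*J*L^2*X := by
    rw [hmR]
    calc (K:ℝ) * (J * m0) ≤ (2*L^2) * (J * (2*X)) := by gcongr
      _ = _ := by ring
  have hmn : (m:ℝ) ≤ (n:ℝ)^2/4 := by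
    refine hmX.trans ?_
    have : 4*J*L^2*X = (16*J*L^2*P) * ((n:ℝ)^2/4) := by rw [hXe]; ring
    rw [this]
    exact mul_le_of_le_one_left (by positivity) hLm
  have hmN : m ≤ (allEdges n).card := by exact_mod_cast hmn.trans hN4
  obtain ⟨j, hj⟩ := Nat.exists_eq_add_of_le hmN
  have hjn : (j:ℝ) ≤ (n:ℝ)^2 := by
    have h1 : (j:ℝ) ≤ (allEdges n).card := by exact_mod_cast (by omega)
    have h2 : 0 ≤ (n:ℝ)^2 := by positivity
    linarith
  have hp : (m:ℝ) / (allEdges n).card ≤ 16*J*L^2*P := by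
    rw [div_le_iff₀ hNpos]
    calc (m:ℝ) ≤ 4*J*L^2*X := hmX
      _ = 16*J*L^2*P * ((n:ℝ)^2/4) := by rw [hXe]; ring
      _ ≤ _ := by gcongr
  set Del := L^(2*e-1) with hDel
  have hDelpos : 0 < Del := by positivity
  have hDel1 : 1 ≤ Del := one_le_pow₀ hL1
  clear_value Del y
  -- q1
  have hq1 : PE m (allEdges n) (fun l => if (∀ u v : Fin n, u ≠ v → Xc Hs u v l.toFinset ≤ Del)
      then (0:ℝ) else 1) ≤ y := by
    rw [← hy2]
    refine q1_bound Hs m Del _ fun u v => ?_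
    set k := ⌈L⌉₊ with hk
    have hk1 : L ≤ k := Nat.le_ceil _
    have hk2 : (k:ℝ) ≤ 2*L := by
      have := Nat.ceil_lt_add_one hL0.le
      linarith
    set B := D0 β * (2^e * (8*e*L)^(2*(e-1))) with hB
    have hB0 : 0 ≤ B := by positivity
    have hw1 : 1 ≤ 8*e*L := one_le_mul_of_one_le_of_one_le (by linarith) hL1
    have h16 : 16*J*L^2 ≤ (8*e*L)^2 := by
      have h0 : 16*(J:ℝ) ≤ 64*(e:ℝ)^2 := by clear * - hJe' he2'; nlinarith
      calc 16*J*L^2 ≤ 64*(e:ℝ)^2*L^2 := by gcongr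
        _ = _ := by ring
    clear_value k
    have h1 := Xc_tail Hs e he u v m hmN B k hB0 (fun U hU => by
      refine hF2 _ (8*e*L)
        (div_nonneg (Nat.cast_nonneg _) (Nat.cast_nonneg _)) hw1 ?_ u v U ?_
      · refine hp.trans (mul_le_mul_of_nonneg_right ?_ hP0)
        exact h16
      · have hU' : (U.card:ℝ) ≤ k*e := by exact_mod_cast hU
        have h3 : (k:ℝ)*e ≤ 2*L*e := by gcongr
        have h4 : 0 ≤ (e:ℝ)*L := by positivity
        linarith) Del hDelpos
    refine le_trans ?_ (h1.trans ?_)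
    · exact le_of_eq (by congr)
    have h2 : B/Del ≤ Real.exp (-(c+10)) := by
      have e1 : Del = L^(2*(e-1)) * L := by
        rw [hDel, ← pow_succ]; congr 1; omega
      rw [div_le_iff₀ hDelpos, e1, hB, mul_pow, Real.exp_neg]
      have hq : 0 < L^(2*(e-1)) := by positivity
      have h3 : D0 β * (2^e * (8*(e:ℝ))^(2*(e-1))) ≤ (Real.exp (c+10))⁻¹ * L := by
        rw [inv_mul_eq_div, le_div_iff₀ (Real.exp_pos _)]
        exact hLD
      have h4 := mul_le_mul_of_nonneg_right h3 hq.le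
      generalize L^(2*(e-1)) = u at *
      generalize (8*(e:ℝ))^(2*(e-1)) = v at *
      linarith
    calc (B/Del)^k ≤ (Real.exp (-(c+10)))^k := by gcongr
      _ = Real.exp (k * (-(c+10))) := by rw [Real.exp_nat_mul]
      _ ≤ _ := by
        apply Real.exp_le_exp.2
        have : (c+10)*L ≤ (c+10)*k := by gcongr
        linarith
  -- q2
  have hq2 : ∀ k, m ≤ k → k + 1 ≤ (allEdges n).card →
      j * PE (k+1) (allEdges n) (sv Hs) ≤ y := by
    intro k hk hkN
    have h1 := hsurv m0 hm0 hm0P K k (hm ▸ hk) hkN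
    rw [← hy2]
    have h2 : (1-δ)^K ≤ Real.exp (-((c+10)*L)) := by
      calc (1-δ)^K ≤ (Real.exp (-δ))^K := by
            gcongr
            linarith [Real.add_one_le_exp (-δ)]
        _ = Real.exp (K * (-δ)) := by rw [Real.exp_nat_mul]
        _ ≤ _ := by
          apply Real.exp_le_exp.2
          have h3 : (c+10)*L ≤ δ*L*L := by gcongr
          have h4 : δ*L^2 ≤ δ*K := by gcongr
          linarith
    exact mul_le_mul hjn (h1.trans h2)
      (PE_nonneg _ _ _ fun l _ => sv_nonneg Hs l) (by positivity)
  have hy1 : y ≤ 1 := by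
    rw [hy, Real.exp_le_one_iff]
    have : 0 ≤ c*L := by positivity
    linarith
  have hy3 : (n:ℝ)^3 * y ≤ 1 := by
    rw [hy, hexp, ← Real.exp_nat_mul, ← Real.exp_add, Real.exp_le_one_iff]
    have : 0 ≤ c*L := by positivity
    push_cast; linarith
  set t := √X * L^(2*e+1) with ht
  have hsX : 1 ≤ √X := by rw [Real.one_le_sqrt]; exact hX1
  have ht1 : 1 ≤ t := one_le_mul_of_one_le_of_one_le hsX (one_le_pow₀ hL1)
  clear_value t
  have hT : t + (1 + (1 + e * Del)) * m * y + y ≤ √EM * L^(4*e) := by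
    have h1 : (1 + (1 + e * Del)) * m * y ≤ 1 := by
      have h2 : (1 + (1 + e * Del)) ≤ (n:ℝ) := by linarith
      calc (1 + (1 + e * Del)) * m * y ≤ n * (n:ℝ)^2 * y := by
            gcongr
            linarith [sq_nonneg (n:ℝ)]
        _ = (n:ℝ)^3 * y := by ring
        _ ≤ 1 := hy3
    have h3 : 3 * t ≤ √EM * L^(4*e) := by
      calc 3 * t ≤ (√(1/(32*(D0 β + 1))) * L) * t := by gcongr
        _ = √((1/(32*(D0 β + 1))) * X) * L^(2*e+2) := by
          rw [Real.sqrt_mul (by positivity), ht]; ring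
        _ ≤ √EM * L^(4*e) := by
          gcongr
          omega
    linarith
  have hfin := hmain m j hmpos hj.symm Del t y y hDelpos.le (by linarith) hq1 hq2 hy0.le
    (√EM * L^(4*e)) hT
  refine le_trans hfin ?_
  have hexpo : (c+8)*L ≤ t ^ 2 / (2 * m * (2 * (1 + e * Del)) ^ 2) := by
    rw [le_div_iff₀ (by positivity)]
    have h1 : 1 + e*Del ≤ (1+e)*Del := by linarith
    have h2 : t^2 = X * L^(4*e+2) := by
      rw [ht, mul_pow, Real.sq_sqrt (by linarith), ← pow_mul]; congr 2; ring
    calc (c+8)*L * (2 * m * (2 * (1 + e * Del)) ^ 2)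
        ≤ (c+8)*L * (2 * (4*J*L^2*X) * (2 * ((1+e)*Del)) ^ 2) := by gcongr
      _ = (32*J*(1+(e:ℝ))^2*(c+8)) * L * X * (L^2 * Del^2) := by ring
      _ ≤ L * L * X * (L^2 * Del^2) := by gcongr
      _ = X * (L * L * (L^2 * L^((2*e-1)*2))) := by rw [hDel, ← pow_mul]; ring
      _ = X * L^(4*e+2) := by
        congr 1
        rw [← pow_add, ← sq, ← pow_add]; congr 1; omega
      _ = t^2 := h2.symm
  have h5 : Real.exp (-(t ^ 2 / (2 * m * (2 * (1 + e * Del)) ^ 2))) ≤ y := by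
    rw [hy]; exact Real.exp_le_exp.2 (by linarith)
  have h6 : 4 * y ≤ (n:ℝ)^(-c) := by
    rw [hexp, ← Real.exp_mul]
    calc 4 * y ≤ Real.exp L * y := by gcongr; linarith
      _ = Real.exp (L + -((c+8)*L)) := by rw [Real.exp_add, ← hy]
      _ ≤ _ := Real.exp_le_exp.2 (by clear * - hL0; nlinarith)
  linarith

lemma ev_all (v e J : ℕ) (d : ℝ) (hd : 0 < d) (δ : ℝ) (hδ : 0 < δ) (s : ℝ) (hs : 0 < s)
    (c1 c2 c3 : ℝ) : ∀ᶠ n : ℕ in Filter.atTop, v ≤ n ∧ 4 ≤ n ∧ 1 ≤ Real.log n ∧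
      c1 ≤ δ * Real.log n ∧ c2 ≤ Real.log n ∧ c3 ≤ Real.log n ∧ 3 ≤ s * Real.log n ∧
      16 * J * Real.log n ^ 2 * (n:ℝ) ^ (-(1/d)) ≤ 1 ∧
      (2 + (e:ℝ)) * Real.log n ^ (2*e-1) ≤ n := by
  have hcast := tendsto_natCast_atTop_atTop (R := ℝ)
  have hlog : Filter.Tendsto (fun n : ℕ => Real.log n) Filter.atTop Filter.atTop :=
    Real.tendsto_log_atTop.comp hcast
  have h8 : ∀ᶠ x : ℝ in Filter.atTop, 16 * J * Real.log x ^ 2 * x ^ (-(1/d)) ≤ 1 := by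
    have h := (isLittleO_log_rpow_rpow_atTop (2:ℝ) (by positivity : 0 < 1/d)).def
      (by positivity : (0:ℝ) < 1/(16*J+1))
    filter_upwards [h, Filter.eventually_ge_atTop 1] with x hx hx1
    have hx0 : 0 < x := by linarith
    have hp : 0 < x ^ (1/d) := by positivity
    rw [Real.norm_of_nonneg hp.le, Real.rpow_two, Real.norm_of_nonneg (by positivity),
      div_mul_eq_mul_div, one_mul, le_div_iff₀ (by positivity)] at hx
    rw [Real.rpow_neg hx0.le, ← div_eq_mul_inv, div_le_one hp]
    nlinarith [sq_nonneg (Real.log x)]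
  have h9 : ∀ᶠ x : ℝ in Filter.atTop, (2 + (e:ℝ)) * Real.log x ^ (2*e-1) ≤ x := by
    have h := (Real.isLittleO_pow_log_id_atTop (n := 2*e-1)).def
      (by positivity : (0:ℝ) < 1/(2+e))
    filter_upwards [h, Filter.eventually_ge_atTop 1] with x hx hx1
    have hx0 : 0 < x := by linarith
    have hl := Real.log_nonneg hx1
    rw [id, Real.norm_of_nonneg hx0.le, Real.norm_of_nonneg (by positivity),
      div_mul_eq_mul_div, one_mul, le_div_iff₀ (by positivity)] at hx
    linarith
  filter_upwards [Filter.eventually_ge_atTop v, Filter.eventually_ge_atTop 4,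
    hlog.eventually_ge_atTop 1, hlog.eventually_ge_atTop (c1/δ), hlog.eventually_ge_atTop c2,
    hlog.eventually_ge_atTop c3, hlog.eventually_ge_atTop (3/s), hcast.eventually h8,
    hcast.eventually h9] with n a1 a2 a3 a4 a5 a6 a7 a8 a9
  refine ⟨a1, a2, a3, ?_, a5, a6, ?_, a8, a9⟩
  · rw [div_le_iff₀ hδ] at a4; linarith
  · rw [div_le_iff₀ hs] at a7; linarith

end Num
/-- **Final number of edges in the reverse `𝓗`-free process for a family of forbidden
graphs** (Theorem 1.16 of Warnke). `𝓗 = {H_1, …, H_r}` is a family of 2-balanced graphs,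
`H = Hs i₀` has minimal `d₂` and `J = Hs j₀` has the maximal number of edges. -/
theorem reverse_family_free_final_edges {r : ℕ} {β : Fin r → Type*}
    [∀ i, Fintype (β i)] (Hs : ∀ i, SimpleGraph (β i))
    (hHs : ∀ i, TwoBalanced (Hs i))
    (i₀ : Fin r) (hi₀ : ∀ i, d2 (Hs i₀) ≤ d2 (Hs i))
    (j₀ : Fin r) (hj₀ : ∀ i, (Hs i).edgeSet.ncard ≤ (Hs j₀).edgeSet.ncard) :
    ∃ a A : ℝ, 0 < a ∧ 0 < A ∧
      (∃ n₀ : ℕ, ∀ n ≥ n₀,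
        a * (n : ℝ) ^ (2 - 1 / d2 (Hs i₀)) ≤ expEdges (reverseFinalFam Hs n) ∧
        expEdges (reverseFinalFam Hs n) ≤ A * (n : ℝ) ^ (2 - 1 / d2 (Hs i₀))) ∧
      ∀ c : ℝ, 0 < c → ∃ n₀ : ℕ, ∀ n ≥ n₀,
        ENNReal.ofReal (1 - (n : ℝ) ^ (-c)) ≤
          prOf (reverseFinalFam Hs n)
            {s | |(s.card : ℝ) - expEdges (reverseFinalFam Hs n)| ≤
              Real.sqrt (expEdges (reverseFinalFam Hs n)) *
                Real.log n ^ (4 * (Hs j₀).edgeSet.ncard)} := by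
  obtain ⟨a0, b0, hab⟩ := exists_adj (hHs i₀)
  have hδ := dl_pos (hHs i₀) hab
  have hJ := (card_ge_three (hHs i₀) hab).2.card_pos
  have hJ' : (0:ℝ) < (JJ (Hs i₀) a0 b0).card := by exact_mod_cast hJ
  have hD := D0_nonneg (β := β)
  refine ⟨1/(32*(D0 β + 1)), 2 * (JJ (Hs i₀) a0 b0).card / dl (Hs i₀) a0 b0, by positivity,
    by positivity, ⟨max (2 * Fintype.card (β i₀)) 4, fun n hn => ?_⟩, fun c hc => ?_⟩
  · rw [expEdges_eq]
    exact ⟨EM_lower Hs hHs i₀ hi₀ (le_of_max_le_right hn),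
      EM_upper Hs hHs i₀ a0 b0 hab (le_of_max_le_left hn) (le_of_max_le_right hn)⟩
  · have ev := ev_all (2 * Fintype.card (β i₀)) (Hs j₀).edgeSet.ncard (JJ (Hs i₀) a0 b0).card
      (d2 (Hs i₀)) (d2_pos (hHs i₀)) (dl (Hs i₀) a0 b0) hδ (√(1/(32*(D0 β + 1)))) (by positivity)
      (c + 10) (32 * (JJ (Hs i₀) a0 b0).card * (1 + ((Hs j₀).edgeSet.ncard:ℝ))^2 * (c + 8))
      (D0 β * (2^((Hs j₀).edgeSet.ncard) *
        (8*((Hs j₀).edgeSet.ncard:ℝ))^(2*((Hs j₀).edgeSet.ncard-1))) * Real.exp (c+10))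
    obtain ⟨n₀, hn₀⟩ := Filter.eventually_atTop.1 ev
    refine ⟨n₀, fun n hn => ?_⟩
    obtain ⟨h1, h2, h3, h4, h5, h6, h7, h8, h9⟩ := hn₀ n hn
    rw [expEdges_eq]
    refine prOf_ge Hs n (fun x => |x - _| ≤ _) _ ?_
    have := conc_n Hs hHs i₀ hi₀ a0 b0 hab (Hs j₀).edgeSet.ncard (hHs j₀).1 hj₀ c hc h1 h2
      (Real.log n) rfl h3 h4 h5 h6 h7 h8 h9
    exact this
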